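/- arXiv:2006.02401 — 5 statements merged into one kernel-verified Lean document; each statement's English description precedes it below -/
import Mathlib

section
/- Every element g of the presented group T̂_τ can be written in the form g = p · c_n^m · q⁻¹, where p and q lie in the submonoid of T̂_τ generated by {x_i, y_i : i ≥ 0}, n ≥ 1 and m ≥ 0. -/
/-!
STATEMENT 2: Every element `g` of the presented group `T̂_τ` can be written in the form
`g = p * c_n ^ m * q⁻¹`, where `p` and `q` lie in the submonoid of `T̂_τ` generated by
`{x_i, y_i : i ≥ 0}`, `n ≥ 1` and `m ≥ 0`.
-/

noncomputable section
/-- Generators of the presented group `T̂_τ`: `x n`, `y n` for `n ≥ 0` and `c n` for `n ≥ 1`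
(indexed by positive naturals). -/
inductive TGen : Type
  | x : ℕ → TGen
  | y : ℕ → TGen
  | c : ℕ+ → TGen

namespace TGen

/-- The free-group generator `x_n`. -/
def X (n : ℕ) : FreeGroup TGen := FreeGroup.of (TGen.x n)
/-- The free-group generator `y_n`. -/
def Y (n : ℕ) : FreeGroup TGen := FreeGroup.of (TGen.y n)
/-- The free-group generator `c_n`, `n ≥ 1`. -/
def C (n : ℕ+) : FreeGroup TGen := FreeGroup.of (TGen.c n)

/-- The defining relators of `T̂_τ` (each relation `u = v` is recorded as `u * v⁻¹`). -/
def TRels : Set (FreeGroup TGen) :=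
  -- (1.1)–(1.4): a_j b_i = b_i a_{j+1} for i < j, a, b ∈ {x, y}
  (⋃ (i : ℕ) (j : ℕ) (_ : i < j),
    ({X j * X i * (X i * X (j + 1))⁻¹,
      X j * Y i * (Y i * X (j + 1))⁻¹,
      Y j * X i * (X i * Y (j + 1))⁻¹,
      Y j * Y i * (Y i * Y (j + 1))⁻¹} : Set (FreeGroup TGen))) ∪
  -- (1.5): y_n² = x_n x_{n+1}
  (⋃ (n : ℕ), ({Y n ^ 2 * (X n * X (n + 1))⁻¹} : Set (FreeGroup TGen))) ∪
  -- (2.1) and (3.1): a_k c_{n+1} = c_n a_{k+1} for 1 ≤ k < n, a ∈ {x, y}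
  (⋃ (k : ℕ) (n : ℕ+) (_ : 1 ≤ k) (_ : (k : ℕ) < (n : ℕ)),
    ({X k * C (n + 1) * (C n * X (k + 1))⁻¹,
      Y k * C (n + 1) * (C n * Y (k + 1))⁻¹} : Set (FreeGroup TGen))) ∪
  -- (2.2), (2.3), (2.4), (3.2), for n ≥ 1
  (⋃ (n : ℕ+),
    ({C n * X 0 * (C (n + 1) ^ 2)⁻¹,
      C n * (X (n : ℕ) * C (n + 1))⁻¹,
      C n ^ ((n : ℕ) + 2),
      C n * Y 0 * ((Y ((n : ℕ) + 1))⁻¹ * C (n + 1) ^ 2)⁻¹} : Set (FreeGroup TGen)))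

end TGen

/-- The presented group `T̂_τ`. -/
abbrev ThatTau : Type := PresentedGroup TGen.TRels

/-- The generator `x_n` of `T̂_τ`. -/
def txg (n : ℕ) : ThatTau := PresentedGroup.of (TGen.x n)
/-- The generator `y_n` of `T̂_τ`. -/
def tyg (n : ℕ) : ThatTau := PresentedGroup.of (TGen.y n)
/-- The generator `c_n` of `T̂_τ`, `n ≥ 1`. -/
def tcg (n : ℕ+) : ThatTau := PresentedGroup.of (TGen.c n)

namespace ThatTau

open TGen

theorem mk_eq_mk_of_mem {u v : FreeGroup TGen} (h : u * v⁻¹ ∈ TRels) :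
    PresentedGroup.mk TRels u = PresentedGroup.mk TRels v := by
  have := PresentedGroup.one_of_mem h
  rwa [map_mul, map_inv, mul_inv_eq_one] at this

/-- The generator `c_{n+1}`, indexed from zero. -/
def rot (n : ℕ) : ThatTau := tcg n.succPNat

theorem x_mul_x {i j : ℕ} (h : i < j) : txg j * txg i = txg i * txg (j + 1) :=
  mk_eq_mk_of_mem (u := X j * X i) (v := X i * X (j + 1))
    (.inl <| .inl <| .inl <| by simp only [Set.mem_iUnion]; exact ⟨i, j, h, by simp⟩)

theorem x_mul_y {i j : ℕ} (h : i < j) : txg j * tyg i = tyg i * txg (j + 1) :=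
  mk_eq_mk_of_mem (u := X j * Y i) (v := Y i * X (j + 1))
    (.inl <| .inl <| .inl <| by simp only [Set.mem_iUnion]; exact ⟨i, j, h, by simp⟩)

theorem y_mul_x {i j : ℕ} (h : i < j) : tyg j * txg i = txg i * tyg (j + 1) :=
  mk_eq_mk_of_mem (u := Y j * X i) (v := X i * Y (j + 1))
    (.inl <| .inl <| .inl <| by simp only [Set.mem_iUnion]; exact ⟨i, j, h, by simp⟩)

theorem y_mul_self (n : ℕ) : tyg n * tyg n = txg n * txg (n + 1) := by
  rw [← pow_two]
  exact mk_eq_mk_of_mem (u := Y n ^ 2) (v := X n * X (n + 1))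
    (.inl <| .inl <| .inr <| by simp only [Set.mem_iUnion]; exact ⟨n, by simp⟩)

theorem rot_mul_x_of_pos {k n : ℕ} (hk : 1 ≤ k) (hn : k ≤ n) :
    rot n * txg (k + 1) = txg k * rot (n + 1) :=
  (mk_eq_mk_of_mem (u := X k * C (n.succPNat + 1)) (v := C n.succPNat * X (k + 1))
    (.inl <| .inr <| by
      simp only [Set.mem_iUnion]
      exact ⟨k, n.succPNat, hk, Nat.lt_succ_of_le hn, by simp⟩)).symm

theorem rot_mul_y_of_pos {k n : ℕ} (hk : 1 ≤ k) (hn : k ≤ n) :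
    rot n * tyg (k + 1) = tyg k * rot (n + 1) :=
  (mk_eq_mk_of_mem (u := Y k * C (n.succPNat + 1)) (v := C n.succPNat * Y (k + 1))
    (.inl <| .inr <| by
      simp only [Set.mem_iUnion]
      exact ⟨k, n.succPNat, hk, Nat.lt_succ_of_le hn, by simp⟩)).symm

theorem rot_mul_x_zero (n : ℕ) : rot n * txg 0 = rot (n + 1) ^ 2 :=
  mk_eq_mk_of_mem (u := C n.succPNat * X 0) (v := C (n.succPNat + 1) ^ 2)
    (.inr <| by simp only [Set.mem_iUnion]; exact ⟨n.succPNat, by simp⟩)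

theorem rot_eq_x_mul (n : ℕ) : rot n = txg (n + 1) * rot (n + 1) :=
  mk_eq_mk_of_mem (u := C n.succPNat) (v := X (n + 1) * C (n.succPNat + 1))
    (.inr <| by simp only [Set.mem_iUnion]; exact ⟨n.succPNat, by simp⟩)

theorem rot_pow (n : ℕ) : rot n ^ (n + 3) = 1 :=
  PresentedGroup.one_of_mem (x := C n.succPNat ^ (n + 3))
    (.inr <| by simp only [Set.mem_iUnion]; exact ⟨n.succPNat, by simp⟩)

theorem rot_mul_y_zero (n : ℕ) : rot n * tyg 0 = (tyg (n + 2))⁻¹ * rot (n + 1) ^ 2 :=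
  mk_eq_mk_of_mem (u := C n.succPNat * Y 0) (v := (Y (n + 2))⁻¹ * C (n.succPNat + 1) ^ 2)
    (.inr <| by simp only [Set.mem_iUnion]; exact ⟨n.succPNat, by simp⟩)

theorem pow_mul_shift {G : Type*} [Group G] {c d : G} {z : ℕ → G} {n : ℕ}
    (h : ∀ k, 1 ≤ k → k ≤ n → c * z (k + 1) = z k * d) : c ^ n * z (n + 1) = z 1 * d ^ n := by
  induction n with
  | zero => simp
  | succ n ih =>
    rw [pow_succ, mul_assoc, h (n + 1) (by omega) le_rfl, ← mul_assoc,
      ih fun k hk hn => h k hk (by omega), mul_assoc, ← pow_succ]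

theorem rot_mul_x_one (n : ℕ) : rot n * txg 1 = txg 0 * rot (n + 1) := by
  have h := pow_mul_shift (c := rot n) (d := rot (n + 1)) (z := txg) (n := n)
    fun k => rot_mul_x_of_pos
  have h₁ : rot n ^ 2 * txg 1 * rot (n + 1) ^ (n + 1) = 1 := calc
    _ = rot n ^ 2 * (txg 1 * rot (n + 1) ^ n) * rot (n + 1) := by
      simp only [pow_succ, mul_assoc]
    _ = rot n ^ 2 * rot n ^ n * (txg (n + 1) * rot (n + 1)) := by
      rw [← h]; simp only [mul_assoc]
    _ = rot n ^ (n + 3) := by rw [← rot_eq_x_mul, ← pow_add, ← pow_succ]; congr 1; omega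
    _ = 1 := rot_pow n
  have h₂ : rot n * txg 0 * rot (n + 1) * rot (n + 1) ^ (n + 1) = 1 := by
    rw [rot_mul_x_zero, ← rot_pow (n + 1), ← pow_succ, ← pow_add]; congr 1; omega
  have h₃ := mul_right_cancel (h₁.trans h₂.symm)
  rw [pow_two, mul_assoc, mul_assoc] at h₃
  exact mul_left_cancel h₃

theorem rot_mul_y_inv (n : ℕ) : rot n * (tyg (n + 2))⁻¹ = tyg (n + 1) * rot (n + 1) := by
  have h₁ := rot_mul_y_of_pos (k := n + 1) (n := n + 1) (by omega) le_rfl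
  have h₂ := rot_eq_x_mul n
  have h₃ := rot_eq_x_mul (n + 1)
  have h₄ := y_mul_self (n + 1)
  rw [mul_inv_eq_iff_eq_mul, mul_assoc, h₁, h₂, ← mul_assoc, h₄, mul_assoc, ← h₃]

theorem rot_mul_y_one (n : ℕ) : rot n * tyg 1 = tyg 0 * rot (n + 1) := by
  have h := pow_mul_shift (c := rot n) (d := rot (n + 1)) (z := tyg) (n := n)
    fun k => rot_mul_y_of_pos
  have h₁ : rot n ^ 2 * tyg 1 * rot (n + 1) ^ (n + 1) = (tyg (n + 2))⁻¹ := calc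
    _ = rot n ^ 2 * (tyg 1 * rot (n + 1) ^ n) * rot (n + 1) := by
      simp only [pow_succ, mul_assoc]
    _ = rot n ^ 2 * rot n ^ n * (tyg (n + 1) * rot (n + 1)) := by
      rw [← h]; simp only [mul_assoc]
    _ = rot n ^ (n + 3) * (tyg (n + 2))⁻¹ := by
      rw [← rot_mul_y_inv, ← pow_add, ← mul_assoc, ← pow_succ]; congr 2; omega
    _ = (tyg (n + 2))⁻¹ := by rw [rot_pow, one_mul]
  have h₂ : rot n * tyg 0 * rot (n + 1) * rot (n + 1) ^ (n + 1) = (tyg (n + 2))⁻¹ := by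
    rw [rot_mul_y_zero, mul_assoc, mul_assoc, ← pow_succ', ← pow_add,
      show 2 + (n + 1 + 1) = n + 1 + 3 by omega, rot_pow, mul_one]
  have h₃ := mul_right_cancel (h₁.trans h₂.symm)
  rw [pow_two, mul_assoc, mul_assoc] at h₃
  exact mul_left_cancel h₃

theorem rot_mul_x {k n : ℕ} (h : k ≤ n) : rot n * txg (k + 1) = txg k * rot (n + 1) := by
  rcases k.eq_zero_or_pos with rfl | hk
  · exact rot_mul_x_one n
  · exact rot_mul_x_of_pos hk h

theorem rot_mul_y {k n : ℕ} (h : k ≤ n) : rot n * tyg (k + 1) = tyg k * rot (n + 1) := by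
  rcases k.eq_zero_or_pos with rfl | hk
  · exact rot_mul_y_one n
  · exact rot_mul_y_of_pos hk h

theorem exists_rot_pow_inv (n m : ℕ) : ∃ l, (rot n ^ m)⁻¹ = rot n ^ l := by
  refine ⟨m * (n + 2), inv_eq_of_mul_eq_one_right ?_⟩
  rw [← pow_add, show m + m * (n + 2) = (n + 3) * m by ring, pow_mul, rot_pow, one_pow]

/-- The submonoid generated by the `x_i`. -/
def xMonoid : Submonoid ThatTau := Submonoid.closure (Set.range txg)

/-- The submonoid generated by the `x_i` and the `y_i`. -/
def xyMonoid : Submonoid ThatTau := Submonoid.closure (Set.range txg ∪ Set.range tyg)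

theorem x_mem (i : ℕ) : txg i ∈ xMonoid := Submonoid.subset_closure ⟨i, rfl⟩

theorem y_mem (i : ℕ) : tyg i ∈ xyMonoid := Submonoid.subset_closure (.inr ⟨i, rfl⟩)

theorem xMonoid_le : xMonoid ≤ xyMonoid := Submonoid.closure_mono Set.subset_union_left

theorem xMonoid_induction {P : ∀ w, w ∈ xMonoid → Prop} (one : P 1 (one_mem _))
    (mul_x : ∀ w hw i, P w hw → P (w * txg i) (mul_mem hw (x_mem i)))
    {w : ThatTau} (hw : w ∈ xMonoid) : P w hw := by
  induction hw using Submonoid.closure_induction_right with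
  | one => exact one
  | mul_right w hw u hu ih =>
    obtain ⟨i, rfl⟩ := hu
    exact mul_x w hw i ih

theorem xyMonoid_induction {P : ∀ p, p ∈ xyMonoid → Prop} (one : P 1 (one_mem _))
    (mul_x : ∀ p hp i, P p hp → P (p * txg i) (mul_mem hp (xMonoid_le (x_mem i))))
    (mul_y : ∀ p hp i, P p hp → P (p * tyg i) (mul_mem hp (y_mem i)))
    {p : ThatTau} (hp : p ∈ xyMonoid) : P p hp := by
  induction hp using Submonoid.closure_induction_right with
  | one => exact one
  | mul_right p hp u hu ih =>
    rcases hu with ⟨i, rfl⟩ | ⟨i, rfl⟩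
    · exact mul_x p hp i ih
    · exact mul_y p hp i ih

/-! ### Common right multiples -/

theorem x_common_multiple {b : ThatTau} (hb : b ∈ xMonoid) (i : ℕ) :
    ∃ t ∈ xMonoid, (∃ j, txg i * t = b * txg j) ∨ txg i * t = b := by
  induction hb using xMonoid_induction with
  | one => exact ⟨1, one_mem _, .inl ⟨i, by simp⟩⟩
  | mul_x b hb k ih =>
    obtain ⟨t, ht, ⟨j, h⟩ | h⟩ := ih
    · rcases lt_trichotomy j k with hjk | rfl | hjk
      · exact ⟨t * txg (k + 1), mul_mem ht (x_mem _), .inl ⟨j, by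
          rw [← mul_assoc, h, mul_assoc, mul_assoc, x_mul_x hjk]⟩⟩
      · exact ⟨t, ht, .inr h⟩
      · exact ⟨t * txg k, mul_mem ht (x_mem _), .inl ⟨j + 1, by
          rw [← mul_assoc, h, mul_assoc, mul_assoc, x_mul_x hjk]⟩⟩
    · exact ⟨t * txg k, mul_mem ht (x_mem _), .inr (by rw [← mul_assoc, h])⟩

theorem xMonoid_common_multiple {a b : ThatTau} (ha : a ∈ xMonoid) (hb : b ∈ xMonoid) :
    ∃ s ∈ xMonoid, ∃ t ∈ xMonoid, a * s = b * t := by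
  induction ha using xMonoid_induction with
  | one => exact ⟨b, hb, 1, one_mem _, by simp⟩
  | mul_x a ha i ih =>
    obtain ⟨s, hs, t, ht, h⟩ := ih
    obtain ⟨r, hr, q, hq, hrq⟩ : ∃ r ∈ xMonoid, ∃ q ∈ xMonoid, txg i * r = s * q := by
      obtain ⟨r, hr, ⟨j, h'⟩ | h'⟩ := x_common_multiple hs i
      · exact ⟨r, hr, _, x_mem j, h'⟩
      · exact ⟨r, hr, 1, one_mem _, by simpa using h'⟩
    exact ⟨r, hr, t * q, mul_mem ht hq, by rw [mul_assoc, hrq, ← mul_assoc, h, mul_assoc]⟩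

theorem y_mul_x_mul_x (i : ℕ) :
    tyg i * (txg i * txg (i + 1)) = txg i * (tyg i * txg (i + 2)) := by
  rw [← y_mul_self, ← mul_assoc, y_mul_self, mul_assoc, x_mul_y (Nat.lt_succ_self i)]

theorem y_x_common_multiple (k i : ℕ) :
    ∃ a ∈ xMonoid, ∃ j, ∃ b ∈ xMonoid, tyg k * a = txg i * (tyg j * b) := by
  rcases lt_trichotomy k i with h | rfl | h
  · exact ⟨_, x_mem (i + 1), k, 1, one_mem _, by rw [← x_mul_y h, mul_one]⟩
  · exact ⟨_, mul_mem (x_mem k) (x_mem (k + 1)), k, _, x_mem (k + 2), y_mul_x_mul_x k⟩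
  · exact ⟨_, x_mem i, k + 1, 1, one_mem _, by rw [y_mul_x h, mul_one]⟩

theorem y_common_multiple {w : ThatTau} (hw : w ∈ xMonoid) (j : ℕ) :
    ∃ a ∈ xMonoid, ∃ k, ∃ b ∈ xMonoid, tyg j * a = w * (tyg k * b) := by
  induction hw using xMonoid_induction with
  | one => exact ⟨1, one_mem _, j, 1, one_mem _, by simp⟩
  | mul_x w hw i ih =>
    obtain ⟨a, ha, k, b, hb, h⟩ := ih
    obtain ⟨a', ha', k', b', hb', h'⟩ := y_x_common_multiple k i
    obtain ⟨s, hs, t, ht, hst⟩ := xMonoid_common_multiple hb ha'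
    refine ⟨a * s, mul_mem ha hs, k', b' * t, mul_mem hb' ht, ?_⟩
    calc tyg j * (a * s) = w * (tyg k * (b * s)) := by
          rw [← mul_assoc, h]; simp only [mul_assoc]
      _ = w * ((tyg k * a') * t) := by rw [hst]; simp only [mul_assoc]
      _ = _ := by rw [h']; simp only [mul_assoc]

theorem xyMonoid_common_multiple {p w : ThatTau} (hp : p ∈ xyMonoid) (hw : w ∈ xMonoid) :
    ∃ a ∈ xMonoid, ∃ b ∈ xyMonoid, p * a = w * b := by
  induction hp using xyMonoid_induction with
  | one => exact ⟨w, hw, 1, one_mem _, by simp⟩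
  | mul_x p hp i ih =>
    obtain ⟨a, ha, b, hb, h⟩ := ih
    obtain ⟨s, hs, t, ht, hst⟩ := xMonoid_common_multiple (x_mem i) ha
    exact ⟨s, hs, b * t, mul_mem hb (xMonoid_le ht), by
      rw [mul_assoc, hst, ← mul_assoc, h, mul_assoc]⟩
  | mul_y p hp i ih =>
    obtain ⟨a, ha, b, hb, h⟩ := ih
    obtain ⟨s, hs, k, t, ht, hst⟩ := y_common_multiple ha i
    exact ⟨s, hs, b * (tyg k * t), mul_mem hb (mul_mem (y_mem k) (xMonoid_le ht)), by
      rw [mul_assoc, hst, ← mul_assoc, h, mul_assoc]⟩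

/-! ### Moving powers of `c_n` to the right -/

theorem rot_pow_mul_of_x_form {n : ℕ} {g : ThatTau}
    (hg : ∃ l, g = rot (n + 1) ^ l ∨ ∃ i ≤ n + 1, g = txg i * rot (n + 1) ^ l) (m : ℕ) :
    ∃ w ∈ xMonoid, ∃ l, rot n ^ m * g = w * rot (n + 1) ^ l := by
  suffices h : ∃ l, rot n ^ m * g = rot (n + 1) ^ l ∨
      ∃ i ≤ n + 1, rot n ^ m * g = txg i * rot (n + 1) ^ l by
    obtain ⟨l, h | ⟨i, -, h⟩⟩ := h
    · exact ⟨1, one_mem _, l, by rw [h, one_mul]⟩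
    · exact ⟨_, x_mem i, l, h⟩
  induction m with
  | zero => simpa using hg
  | succ m ih =>
    obtain ⟨l, h | ⟨i, hi, h⟩⟩ := ih
    · exact ⟨l + 1, .inr ⟨n + 1, le_rfl, by
        rw [pow_succ', mul_assoc, h, rot_eq_x_mul n, pow_succ', mul_assoc]⟩⟩
    · rcases i with _ | i
      · exact ⟨2 + l, .inl (by
          rw [pow_succ', mul_assoc, h, ← mul_assoc, rot_mul_x_zero, pow_add])⟩
      · exact ⟨l + 1, .inr ⟨i, by omega, by
          rw [pow_succ', mul_assoc, h, ← mul_assoc, rot_mul_x (by omega), pow_succ', mul_assoc]⟩⟩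

theorem rot_pow_lift {n N : ℕ} (h : n ≤ N) (m : ℕ) :
    ∃ w ∈ xMonoid, ∃ l, rot n ^ m = w * rot N ^ l := by
  induction N, h using Nat.le_induction with
  | base => exact ⟨1, one_mem _, m, by simp⟩
  | succ N _ ih =>
    obtain ⟨w, hw, l, h⟩ := ih
    obtain ⟨w', hw', l', h'⟩ := rot_pow_mul_of_x_form (n := N) (g := 1) ⟨0, .inl (by simp)⟩ l
    exact ⟨w * w', mul_mem hw hw', l', by rw [h, mul_assoc, ← h', mul_one]⟩

theorem rot_pow_lift_right {n N : ℕ} (h : n ≤ N) (m : ℕ) :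
    ∃ w ∈ xMonoid, ∃ l, rot n ^ m = rot N ^ l * w⁻¹ := by
  obtain ⟨m', hm⟩ := exists_rot_pow_inv n m
  obtain ⟨w, hw, l, h⟩ := rot_pow_lift h m'
  obtain ⟨l', hl⟩ := exists_rot_pow_inv N l
  exact ⟨w, hw, l', by rw [← inv_inv (rot n ^ m), hm, h, mul_inv_rev, hl]⟩

theorem rot_pow_mul_xMonoid {w : ThatTau} (hw : w ∈ xMonoid) (n m : ℕ) :
    ∃ w' ∈ xMonoid, ∃ k l, rot n ^ m * w = w' * rot k ^ l := by
  induction hw using xMonoid_induction with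
  | one => exact ⟨1, one_mem _, n, m, by simp⟩
  | mul_x w hw i ih =>
    obtain ⟨w₁, hw₁, k, l, h⟩ := ih
    obtain ⟨w₂, hw₂, l₂, h₂⟩ := rot_pow_lift (le_max_left k i) l
    obtain ⟨w₃, hw₃, l₃, h₃⟩ := rot_pow_mul_of_x_form (n := max k i) (g := txg i)
      ⟨0, .inr ⟨i, by omega, by simp⟩⟩ l₂
    refine ⟨w₁ * (w₂ * w₃), mul_mem hw₁ (mul_mem hw₂ hw₃), max k i + 1, l₃, ?_⟩
    rw [← mul_assoc, h, h₂, mul_assoc, mul_assoc, h₃]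
    simp only [mul_assoc]

theorem xMonoid_inv_mul_rot_pow {w : ThatTau} (hw : w ∈ xMonoid) (n m : ℕ) :
    ∃ w' ∈ xMonoid, ∃ k l, w⁻¹ * rot n ^ m = rot k ^ l * w'⁻¹ := by
  obtain ⟨m', hm⟩ := exists_rot_pow_inv n m
  obtain ⟨w', hw', k, l, h⟩ := rot_pow_mul_xMonoid hw n m'
  obtain ⟨l', hl⟩ := exists_rot_pow_inv k l
  exact ⟨w', hw', k, l', by
    rw [← inv_inv (rot n ^ m), hm, ← mul_inv_rev, h, mul_inv_rev, hl]⟩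

theorem rot_pow_mul_y_of_le {n i : ℕ} (hi : i ≤ n + 1) (m : ℕ) :
    ∃ l, (∃ j ≤ n + 1, rot n ^ m * tyg i = tyg j * rot (n + 1) ^ l) ∨
      rot n ^ m * tyg i = (tyg (n + 2))⁻¹ * rot (n + 1) ^ l := by
  induction m with
  | zero => exact ⟨0, .inl ⟨i, hi, by simp⟩⟩
  | succ m ih =>
    obtain ⟨l, ⟨j, hj, h⟩ | h⟩ := ih
    · rcases j with _ | j
      · exact ⟨2 + l, .inr (by
          rw [pow_succ', mul_assoc, h, ← mul_assoc, rot_mul_y_zero, pow_add, mul_assoc])⟩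
      · exact ⟨l + 1, .inl ⟨j, by omega, by
          rw [pow_succ', mul_assoc, h, ← mul_assoc, rot_mul_y (by omega), pow_succ', mul_assoc]⟩⟩
    · exact ⟨l + 1, .inl ⟨n + 1, le_rfl, by
        rw [pow_succ', mul_assoc, h, ← mul_assoc, rot_mul_y_inv, pow_succ', mul_assoc]⟩⟩

theorem y_inv_mul_rot_pow (i n m : ℕ) :
    ∃ w ∈ xMonoid, ∃ k l, (tyg i)⁻¹ * rot n ^ m * w = tyg i * rot k ^ l := by
  obtain ⟨m', hm⟩ := exists_rot_pow_inv n m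
  obtain ⟨w, hw, k, l, h⟩ := rot_pow_mul_xMonoid (mul_mem (x_mem i) (x_mem (i + 1))) n m'
  obtain ⟨l', hl⟩ := exists_rot_pow_inv k l
  refine ⟨w, hw, k, l', ?_⟩
  rw [← hm, ← y_mul_self, inv_mul_eq_iff_eq_mul] at h
  rw [mul_assoc, inv_mul_eq_iff_eq_mul, ← mul_assoc, h, ← hl]
  simp only [mul_assoc, mul_inv_cancel, mul_one]

theorem rot_pow_mul_y (n m i : ℕ) :
    ∃ w ∈ xMonoid, ∃ p ∈ xyMonoid, ∃ k l, rot n ^ m * tyg i * w = p * rot k ^ l := by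
  obtain ⟨v, hv, m', h⟩ := rot_pow_lift (le_max_left n i) m
  obtain ⟨l, ⟨j, -, h'⟩ | h'⟩ := rot_pow_mul_y_of_le (n := max n i) (i := i) (by omega) m'
  · exact ⟨1, one_mem _, v * tyg j, mul_mem (xMonoid_le hv) (y_mem j), _, l, by
      rw [h, mul_one, mul_assoc, h', mul_assoc]⟩
  · obtain ⟨w, hw, k, l', h''⟩ := y_inv_mul_rot_pow (max n i + 2) (max n i + 1) l
    exact ⟨w, hw, v * tyg _, mul_mem (xMonoid_le hv) (y_mem _), k, l', by
      rw [h, mul_assoc v, h', mul_assoc v, h'', mul_assoc]⟩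

theorem rot_pow_mul_xyMonoid {p : ThatTau} (hp : p ∈ xyMonoid) (n m : ℕ) :
    ∃ w ∈ xMonoid, ∃ p' ∈ xyMonoid, ∃ k l, rot n ^ m * p * w = p' * rot k ^ l := by
  induction hp using xyMonoid_induction with
  | one => exact ⟨1, one_mem _, 1, one_mem _, n, m, by simp⟩
  | mul_x p hp i ih =>
    obtain ⟨w, hw, p₁, hp₁, k, l, h⟩ := ih
    obtain ⟨s, hs, t, ht, hst⟩ := xMonoid_common_multiple (x_mem i) hw
    obtain ⟨w', hw', k', l', h'⟩ := rot_pow_mul_xMonoid ht k l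
    refine ⟨s, hs, p₁ * w', mul_mem hp₁ (xMonoid_le hw'), k', l', ?_⟩
    calc rot n ^ m * (p * txg i) * s = rot n ^ m * p * w * t := by
          simp only [mul_assoc, hst]
      _ = p₁ * w' * rot k' ^ l' := by rw [h, mul_assoc, h', mul_assoc]
  | mul_y p hp i ih =>
    obtain ⟨w, hw, p₁, hp₁, k, l, h⟩ := ih
    obtain ⟨a, ha, j, b, hb, hab⟩ := y_common_multiple hw i
    obtain ⟨w₁, hw₁, p₂, hp₂, k₂, l₂, h₂⟩ := rot_pow_mul_y k l j
    obtain ⟨s, hs, t, ht, hst⟩ := xMonoid_common_multiple hb hw₁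
    obtain ⟨w₃, hw₃, k₃, l₃, h₃⟩ := rot_pow_mul_xMonoid ht k₂ l₂
    refine ⟨a * s, mul_mem ha hs, p₁ * (p₂ * w₃),
      mul_mem hp₁ (mul_mem hp₂ (xMonoid_le hw₃)), k₃, l₃, ?_⟩
    calc rot n ^ m * (p * tyg i) * (a * s) = rot n ^ m * p * (tyg i * a) * s := by
          simp only [mul_assoc]
      _ = (rot n ^ m * p * w) * (tyg j * (b * s)) := by rw [hab]; simp only [mul_assoc]
      _ = p₁ * ((rot k ^ l * tyg j * w₁) * t) := by rw [h, hst]; simp only [mul_assoc]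
      _ = p₁ * (p₂ * w₃) * rot k₃ ^ l₃ := by rw [h₂, mul_assoc p₂, h₃]; simp only [mul_assoc]

/-! ### Elements admitting a `p c q⁻¹` form -/

/-- `g` can be written as `p * c_n ^ m * q⁻¹` with `p` and `q` positive. -/
def HasForm (g : ThatTau) : Prop :=
  ∃ p ∈ xyMonoid, ∃ q ∈ xyMonoid, ∃ n m, g = p * rot n ^ m * q⁻¹

theorem HasForm.mul_left {g p : ThatTau} (hp : p ∈ xyMonoid) (hg : HasForm g) :
    HasForm (p * g) := by
  obtain ⟨p', hp', q, hq, n, m, rfl⟩ := hg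
  exact ⟨p * p', mul_mem hp hp', q, hq, n, m, by simp only [mul_assoc]⟩

theorem HasForm.x_inv_mul {g : ThatTau} (hg : HasForm g) (i : ℕ) : HasForm ((txg i)⁻¹ * g) := by
  obtain ⟨p, hp, q, hq, n, m, rfl⟩ := hg
  obtain ⟨a, ha, b, hb, h⟩ := xyMonoid_common_multiple hp (x_mem i)
  obtain ⟨w, hw, k, l, h'⟩ := xMonoid_inv_mul_rot_pow ha n m
  refine ⟨b, hb, q * w, mul_mem hq (xMonoid_le hw), k, l, ?_⟩
  have h₁ : (txg i)⁻¹ * p = b * a⁻¹ := by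
    rw [inv_mul_eq_iff_eq_mul, ← mul_assoc, ← h, mul_inv_cancel_right]
  calc (txg i)⁻¹ * (p * rot n ^ m * q⁻¹) = (txg i)⁻¹ * p * (rot n ^ m * q⁻¹) := by
        simp only [mul_assoc]
    _ = b * (a⁻¹ * rot n ^ m) * q⁻¹ := by rw [h₁]; simp only [mul_assoc]
    _ = _ := by rw [h', mul_inv_rev]; simp only [mul_assoc]

theorem HasForm.y_inv_mul {g : ThatTau} (hg : HasForm g) (i : ℕ) : HasForm ((tyg i)⁻¹ * g) := by
  have h : (tyg i)⁻¹ * g = tyg i * ((txg (i + 1))⁻¹ * ((txg i)⁻¹ * g)) := by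
    rw [← mul_assoc (txg (i + 1))⁻¹, ← mul_inv_rev, ← y_mul_self]
    group
  rw [h]
  exact ((hg.x_inv_mul i).x_inv_mul (i + 1)).mul_left (y_mem i)

theorem HasForm.rot_mul {g : ThatTau} (hg : HasForm g) (k : ℕ) : HasForm (rot k * g) := by
  obtain ⟨p, hp, q, hq, n, m, rfl⟩ := hg
  obtain ⟨w, hw, p', hp', k', l, h⟩ := rot_pow_mul_xyMonoid hp k 1
  obtain ⟨w', hw', n', m', h'⟩ := xMonoid_inv_mul_rot_pow hw n m
  obtain ⟨v, hv, l₁, h₁⟩ := rot_pow_lift (le_max_left k' n') l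
  obtain ⟨u, hu, l₂, h₂⟩ := rot_pow_lift_right (le_max_right k' n') m'
  refine ⟨p' * v, mul_mem hp' (xMonoid_le hv), q * (w' * u),
    mul_mem hq (mul_mem (xMonoid_le hw') (xMonoid_le hu)), max k' n', l₁ + l₂, ?_⟩
  rw [pow_one] at h
  calc rot k * (p * rot n ^ m * q⁻¹) = (rot k * p * w) * (w⁻¹ * rot n ^ m) * q⁻¹ := by group
    _ = p' * rot k' ^ l * (rot n' ^ m' * w'⁻¹) * q⁻¹ := by rw [h, h']
    _ = _ := by rw [h₁, h₂, pow_add]; simp only [mul_inv_rev, mul_assoc]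

theorem HasForm.rot_pow_mul {g : ThatTau} (hg : HasForm g) (k m : ℕ) :
    HasForm (rot k ^ m * g) := by
  induction m with
  | zero => simpa using hg
  | succ m ih => rw [pow_succ', mul_assoc]; exact ih.rot_mul k

theorem hasForm (g : ThatTau) : HasForm g := by
  have hg : g ∈ Subgroup.closure (Set.range (PresentedGroup.of (rels := TRels))) := by
    rw [PresentedGroup.closure_range_of]; trivial
  induction hg using Subgroup.closure_induction_left with
  | one => exact ⟨1, one_mem _, 1, one_mem _, 0, 0, by simp⟩
  | mul_left u hu g _ ih =>
    obtain ⟨i | i | k, rfl⟩ := hu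
    · exact ih.mul_left (xMonoid_le (x_mem i))
    · exact ih.mul_left (y_mem i)
    · obtain ⟨k, rfl⟩ : ∃ j : ℕ, j.succPNat = k := ⟨_, k.succPNat_natPred⟩
      exact ih.rot_mul k
  | inv_mul_cancel u hu g _ ih =>
    obtain ⟨i | i | k, rfl⟩ := hu
    · exact ih.x_inv_mul i
    · exact ih.y_inv_mul i
    · obtain ⟨k, rfl⟩ : ∃ j : ℕ, j.succPNat = k := ⟨_, k.succPNat_natPred⟩
      obtain ⟨l, hl⟩ := exists_rot_pow_inv k 1
      have h := ih.rot_pow_mul k l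
      rwa [← hl, pow_one] at h

end ThatTau

/-- Every element of `T̂_τ` has a `p c q⁻¹` form. -/
theorem ThatTau_pcq_form (g : ThatTau) :
    ∃ p q : ThatTau,
      p ∈ Submonoid.closure (Set.range txg ∪ Set.range tyg) ∧
      q ∈ Submonoid.closure (Set.range txg ∪ Set.range tyg) ∧
      ∃ (n : ℕ+) (m : ℕ), g = p * (tcg n) ^ m * q⁻¹ := by
  obtain ⟨p, hp, q, hq, n, m, h⟩ := ThatTau.hasForm g
  exact ⟨p, q, hp, hq, n.succPNat, m, h⟩

end
end

section
/- In the presented group T̂_τ, for every positive integer n the following identities hold: (i) c_n^m = x_{n+1−m} c_{n+1}^m for all 1 ≤ m ≤ n+1, and (ii) c_n^m = c_{n+1}^{m+1} x_{m−1}⁻¹ for all 1 ≤ m ≤ n+1. -/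
/-!
STATEMENT 3: In the presented group `T̂_τ`, for every positive integer `n`:
(i)  `c_n ^ m = x_{n+1−m} * c_{n+1} ^ m` for all `1 ≤ m ≤ n+1`, and
(ii) `c_n ^ m = c_{n+1} ^ (m+1) * x_{m−1}⁻¹` for all `1 ≤ m ≤ n+1`.
-/

noncomputable section
namespace ThatTau

/-- The relation `c_n x_0 = c_{n+1}²`. -/
theorem tcg_mul_txg_zero (n : ℕ+) : tcg n * txg 0 = tcg (n + 1) ^ 2 := by
  have h : TGen.C n * TGen.X 0 * (TGen.C (n + 1) ^ 2)⁻¹ ∈ TGen.TRels :=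
    Or.inr (Set.mem_iUnion.2 ⟨n, by simp⟩)
  exact mul_inv_eq_one.1 (PresentedGroup.one_of_mem h)

/-- The relation `c_n = x_n c_{n+1}`. -/
theorem tcg_eq_txg_mul (n : ℕ+) : tcg n = txg n * tcg (n + 1) := by
  have h : TGen.C n * (TGen.X (n : ℕ) * TGen.C (n + 1))⁻¹ ∈ TGen.TRels :=
    Or.inr (Set.mem_iUnion.2 ⟨n, by simp⟩)
  exact mul_inv_eq_one.1 (PresentedGroup.one_of_mem h)

/-- The relation `c_n ^ (n + 2) = 1`. -/
theorem tcg_pow_add_two (n : ℕ+) : tcg n ^ ((n : ℕ) + 2) = 1 := by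
  have h : TGen.C n ^ ((n : ℕ) + 2) ∈ TGen.TRels :=
    Or.inr (Set.mem_iUnion.2 ⟨n, by simp⟩)
  exact PresentedGroup.one_of_mem h

/-- The relation `c_n x_{k+1} = x_k c_{n+1}` for `1 ≤ k < n`. -/
theorem tcg_mul_txg_succ_of_pos {k : ℕ} {n : ℕ+} (hk : 1 ≤ k) (hkn : k < (n : ℕ)) :
    tcg n * txg (k + 1) = txg k * tcg (n + 1) := by
  have h : TGen.X k * TGen.C (n + 1) * (TGen.C n * TGen.X (k + 1))⁻¹ ∈ TGen.TRels := by
    refine Or.inl (Or.inr ?_)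
    simp only [Set.mem_iUnion]
    exact ⟨k, n, hk, hkn, Or.inl rfl⟩
  exact (mul_inv_eq_one.1 (PresentedGroup.one_of_mem h)).symm

theorem tcg_pow_succ_eq_txg_mul (n : ℕ+) (m : ℕ) (hm : m < (n : ℕ)) :
    tcg n ^ (m + 1) = txg ((n : ℕ) - m) * tcg (n + 1) ^ (m + 1) := by
  induction m with
  | zero => simpa using tcg_eq_txg_mul n
  | succ m ih =>
    have hx : (n : ℕ) - m = (n : ℕ) - (m + 1) + 1 := by lia
    rw [pow_succ', ih (by lia), hx, ← mul_assoc,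
      tcg_mul_txg_succ_of_pos (by lia) (by lia), mul_assoc, ← pow_succ']

theorem tcg_pow_self_add_one (n : ℕ+) :
    tcg n ^ ((n : ℕ) + 1) = txg 0 * tcg (n + 1) ^ ((n : ℕ) + 1) := by
  have h : tcg (n + 1) ^ ((n : ℕ) + 3) = 1 := tcg_pow_add_two (n + 1)
  refine mul_left_cancel (a := tcg n) ?_
  rw [← pow_succ', tcg_pow_add_two, ← mul_assoc, tcg_mul_txg_zero, ← pow_add, ← h]
  congr 1
  lia

/-- The relation `c_n x_{k+1} = x_k c_{n+1}` extends to `k = 0`. -/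
theorem tcg_mul_txg_succ {k : ℕ} {n : ℕ+} (hkn : k < (n : ℕ)) :
    tcg n * txg (k + 1) = txg k * tcg (n + 1) := by
  rcases Nat.eq_zero_or_pos k with rfl | hk
  · have h := tcg_pow_succ_eq_txg_mul n ((n : ℕ) - 1) (by lia)
    have hsub : (n : ℕ) - ((n : ℕ) - 1) = 1 := by lia
    rw [Nat.sub_add_cancel hkn, hsub] at h
    refine mul_right_cancel (b := tcg (n + 1) ^ (n : ℕ)) ?_
    rw [zero_add, mul_assoc, ← h, ← pow_succ', tcg_pow_self_add_one, mul_assoc, ← pow_succ']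
  · exact tcg_mul_txg_succ_of_pos hk hkn

theorem tcg_pow_succ_mul_txg (n : ℕ+) (m : ℕ) (hm : m ≤ (n : ℕ)) :
    tcg n ^ (m + 1) * txg m = tcg (n + 1) ^ (m + 2) := by
  induction m with
  | zero => simpa using tcg_mul_txg_zero n
  | succ m ih =>
    rw [pow_succ, mul_assoc, tcg_mul_txg_succ (by lia), ← mul_assoc, ih (by lia), ← pow_succ]

end ThatTau

/-- Lemma 2.4: identities between the `x`- and `c`-generators in `T̂_τ`. -/
theorem ThatTau_c_x_identities (n : ℕ+) :
    (∀ m : ℕ, 1 ≤ m → m ≤ (n : ℕ) + 1 →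
      (tcg n) ^ m = txg ((n : ℕ) + 1 - m) * (tcg (n + 1)) ^ m) ∧
    (∀ m : ℕ, 1 ≤ m → m ≤ (n : ℕ) + 1 →
      (tcg n) ^ m = (tcg (n + 1)) ^ (m + 1) * (txg (m - 1))⁻¹) := by
  refine ⟨fun m h1 h2 => ?_, fun m h1 h2 => ?_⟩ <;>
    obtain ⟨m, rfl⟩ := Nat.exists_eq_add_of_le' h1
  · rw [Nat.add_sub_add_right]
    rcases (Nat.le_of_succ_le_succ h2).lt_or_eq with h | rfl
    · exact ThatTau.tcg_pow_succ_eq_txg_mul n m h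
    · rw [Nat.sub_self]
      exact ThatTau.tcg_pow_self_add_one n
  · exact eq_mul_inv_of_mul_eq (ThatTau.tcg_pow_succ_mul_txg n m (Nat.le_of_succ_le_succ h2))

end
end

section
/- There exists a surjective group homomorphism φ from the presented group T̂_τ onto ℤ/2ℤ satisfying φ(x_n) = 0 for all n ≥ 0, φ(c_n) = 0 for all n ≥ 1, and φ(y_n) = 1 for all n ≥ 0; consequently its kernel is a normal subgroup of index 2 in T̂_τ. -/
/-!
STATEMENT 4: There exists a surjective group homomorphism `φ` from the presented group `T̂_τ`
onto ℤ/2ℤ with `φ(x_n) = 0` (n ≥ 0), `φ(c_n) = 0` (n ≥ 1) and `φ(y_n) = 1` (n ≥ 0);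
consequently its kernel is a normal subgroup of index 2 in `T̂_τ`.
(ℤ/2ℤ is taken in multiplicative notation as `Multiplicative (ZMod 2)`.)
-/

noncomputable section
/-- The parity of the number of `y`-letters, on generators. -/
def TGen.parity : TGen → Multiplicative (ZMod 2)
  | .x _ => 1
  | .y _ => Multiplicative.ofAdd 1
  | .c _ => 1

theorem TGen.lift_parity_eq_one (r : FreeGroup TGen) (hr : r ∈ TGen.TRels) :
    FreeGroup.lift TGen.parity r = 1 := by
  have hX (n : ℕ) : FreeGroup.lift TGen.parity (TGen.X n) = 1 := FreeGroup.lift_apply_of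
  have hY (n : ℕ) : FreeGroup.lift TGen.parity (TGen.Y n) = Multiplicative.ofAdd 1 :=
    FreeGroup.lift_apply_of
  have hC (n : ℕ+) : FreeGroup.lift TGen.parity (TGen.C n) = 1 := FreeGroup.lift_apply_of
  have hsq : (Multiplicative.ofAdd (1 : ZMod 2)) ^ 2 = 1 := by decide
  simp only [TGen.TRels, Set.mem_union, Set.mem_iUnion, Set.mem_insert_iff,
    Set.mem_singleton_iff] at hr
  rcases hr with ((⟨i, j, -, rfl | rfl | rfl | rfl⟩ | ⟨n, rfl⟩) | ⟨k, n, -, -, rfl | rfl⟩) |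
    ⟨n, rfl | rfl | rfl | rfl⟩ <;>
  simp [hX, hY, hC, hsq, ← pow_two]

/-- The parity-of-`y` homomorphism `T̂_τ → ℤ/2ℤ` exists, is surjective, and its kernel is a
normal subgroup of index 2. -/
theorem ThatTau_parity_hom :
    ∃ φ : ThatTau →* Multiplicative (ZMod 2),
      Function.Surjective φ ∧
      (∀ n : ℕ, φ (txg n) = Multiplicative.ofAdd (0 : ZMod 2)) ∧
      (∀ n : ℕ+, φ (tcg n) = Multiplicative.ofAdd (0 : ZMod 2)) ∧
      (∀ n : ℕ, φ (tyg n) = Multiplicative.ofAdd (1 : ZMod 2)) ∧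
      (MonoidHom.ker φ).Normal ∧ (MonoidHom.ker φ).index = 2 := by
  let φ : ThatTau →* Multiplicative (ZMod 2) :=
    PresentedGroup.toGroup TGen.lift_parity_eq_one
  have hφ (g : TGen) : φ (PresentedGroup.of g) = g.parity := PresentedGroup.toGroup.of _
  have hsurj : Function.Surjective φ := by
    intro z
    have hz : z = 1 ∨ z = Multiplicative.ofAdd 1 := by
      revert z
      decide
    rcases hz with rfl | rfl
    · exact ⟨1, map_one φ⟩
    · exact ⟨tyg 0, hφ _⟩
  refine ⟨φ, hsurj, fun n => hφ _, fun n => hφ _, fun n => hφ _, inferInstance, ?_⟩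
  rw [Subgroup.index_ker, MonoidHom.range_eq_top.mpr hsurj, Subgroup.card_top]
  exact Nat.card_zmod 2

end
end

section
/- Let φ : T̂_τ → ℤ/2ℤ be the group homomorphism with φ(x_n) = 0 for n ≥ 0, φ(c_n) = 0 for n ≥ 1, and φ(y_n) = 1 for n ≥ 0. Then the kernel T_xz of φ is a simple group. -/
/-!
STATEMENT 5: Let `φ : T̂_τ → ℤ/2ℤ` be the group homomorphism with `φ(x_n) = 0` (n ≥ 0),
`φ(c_n) = 0` (n ≥ 1) and `φ(y_n) = 1` (n ≥ 0).  Then the kernel `T_xz` of `φ` is simple.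
(ℤ/2ℤ is taken in multiplicative notation as `Multiplicative (ZMod 2)`.)
-/

noncomputable section
/-- The relations between the generators of `T̂_τ`, for sequences of elements of an arbitrary
group; only the values `c n` with `1 ≤ n` are constrained. -/
structure TauRel {G : Type*} [Group G] (x y c : ℕ → G) : Prop where
  xx : ∀ {i j}, i < j → x j * x i = x i * x (j + 1)
  xy : ∀ {i j}, i < j → x j * y i = y i * x (j + 1)
  yx : ∀ {i j}, i < j → y j * x i = x i * y (j + 1)
  yy : ∀ {i j}, i < j → y j * y i = y i * y (j + 1)
  y_sq : ∀ n, y n * y n = x n * x (n + 1)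
  x_c : ∀ {k n}, 1 ≤ k → k < n → x k * c (n + 1) = c n * x (k + 1)
  y_c : ∀ {k n}, 1 ≤ k → k < n → y k * c (n + 1) = c n * y (k + 1)
  c_x0 : ∀ {n}, 1 ≤ n → c n * x 0 = c (n + 1) * c (n + 1)
  c_eq : ∀ {n}, 1 ≤ n → c n = x n * c (n + 1)
  c_pow : ∀ {n}, 1 ≤ n → c n ^ (n + 2) = 1
  c_y0 : ∀ {n}, 1 ≤ n → y (n + 1) * c n * y 0 = c (n + 1) * c (n + 1)

/-- The elements `x`, `y` of a pair of sequences, selected by a Boolean. -/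
def tauSt {G : Type*} (x y : ℕ → G) : Bool → ℕ → G
  | true => x
  | false => y

/-- The element splitting the `i`-th of the `n + 2` arcs of the circle, by a caret of either
type; the last arc carries the whole right vine. -/
def tauStep {G : Type*} [Group G] (x y : ℕ → G) (n i : ℕ) (z : Bool) : G :=
  if i ≤ n then tauSt x y z i else bif z then 1 else (y (n + 1))⁻¹

/-- Products of successive splittings leading from `n + 2` arcs to `m + 2` arcs. -/
inductive TauPos {G : Type*} [Group G] (x y : ℕ → G) : ℕ → ℕ → G → Prop
  | nil (n : ℕ) : TauPos x y n n 1
  | cons {n m i : ℕ} {z : Bool} {g : G} (hi : i ≤ n + 1) (hg : TauPos x y (n + 1) m g) :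
      TauPos x y n m (tauStep x y n i z * g)

namespace TauRel

variable {G : Type*} [Group G] {x y c : ℕ → G}

theorem c_pow_succ (h : TauRel x y c) {n : ℕ} (hn : 1 ≤ n) :
    ∀ k, k < n → c n ^ (k + 1) = x (n - k) * c (n + 1) ^ (k + 1)
  | 0, _ => by simpa using h.c_eq hn
  | k + 1, hk => by
      have h1 := h.x_c (k := n - (k + 1)) (n := n) (by omega) (by omega)
      rw [pow_succ', c_pow_succ h hn k (by omega), ← mul_assoc,
        show n - k = n - (k + 1) + 1 by omega, ← h1, mul_assoc, ← pow_succ']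

theorem x0_c (h : TauRel x y c) {n : ℕ} (hn : 1 ≤ n) : x 0 * c (n + 1) = c n * x 1 := by
  have h1 := h.c_pow_succ hn (n - 1) (by omega)
  rw [show n - 1 + 1 = n by omega, show n - (n - 1) = 1 by omega] at h1
  have h2 : x 1 = c n ^ n * (c (n + 1) ^ n)⁻¹ := by rw [h1]; group
  have h3 : x 0 = (c n)⁻¹ * (c (n + 1) * c (n + 1)) := by rw [← h.c_x0 hn]; group
  have h4 : c n * c n ^ n = (c n)⁻¹ := by
    rw [eq_inv_iff_mul_eq_one, ← pow_succ', ← pow_succ]; exact h.c_pow hn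
  have h5 : c (n + 1) * c (n + 1) * c (n + 1) = (c (n + 1) ^ n)⁻¹ := by
    rw [eq_inv_iff_mul_eq_one]
    have := h.c_pow (n := n + 1) (by omega)
    rw [← this]
    rw [show n + 1 + 2 = 3 + n by omega, pow_add]; simp [pow_succ]
  rw [h2, h3, ← mul_assoc (c n), h4, ← h5]; group

theorem y0_c_two (h : TauRel x y c) : y 0 * c 3 = c 2 * y 1 := by
  have e1 : x 2 * c 1 * x 0 * x 1 = c 1 * x 0 * x 0 := by
    have a1 := h.c_x0 (n := 1) le_rfl
    have a2 := h.c_x0 (n := 2) (by omega)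
    have a3 := h.x0_c (n := 2) (by omega)
    have a4 := h.c_eq (n := 2) (by omega)
    norm_num at a1 a2 a3 a4
    calc x 2 * c 1 * x 0 * x 1 = x 2 * (c 1 * x 0) * x 1 := by group
      _ = x 2 * c 2 * (c 2 * x 1) := by rw [a1]; group
      _ = x 2 * (c 2 * x 0) * c 3 := by rw [← a3]; group
      _ = (x 2 * c 3) * (c 3 * c 3) := by rw [a2]; group
      _ = c 2 * (c 2 * x 0) := by rw [← a4, ← a2]
      _ = c 1 * x 0 * x 0 := by rw [a1]; group
  have a1 := h.c_x0 (n := 1) le_rfl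
  have a2 := h.c_y0 (n := 1) le_rfl
  have a3 := h.y_c (k := 1) (n := 2) le_rfl (by omega)
  have a4 := h.x_c (k := 1) (n := 2) le_rfl (by omega)
  have a5 := h.x0_c (n := 2) (by omega)
  have a6 := h.c_pow (n := 2) (by omega)
  have a7 := h.y_sq 0
  norm_num at a1 a2 a3 a4 a5 a6 a7
  -- the conjugates of `v k = y k * (x k)⁻¹`
  have b1 : y 0 * (x 0)⁻¹ = (c 1)⁻¹ * (y 2)⁻¹ * c 1 := by
    have : y 0 = (c 1)⁻¹ * (y 2)⁻¹ * (c 1 * x 0) := by rw [a1, ← a2]; group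
    rw [this]; group
  have b2 : x 0 * (y 0 * (x 0)⁻¹) * (x 0)⁻¹ = (c 1)⁻¹ * (y 2 * (x 2)⁻¹) * c 1 := by
    have : x 0 * (y 0 * (x 0)⁻¹) * (x 0)⁻¹
        = (y 0 * (x 0)⁻¹)⁻¹ * (y 0 * y 0) * (x 0)⁻¹ * (x 0)⁻¹ := by group
    rw [this, b1, a7]
    have e2 : c 1 * x 0 * x 1 * (x 0)⁻¹ * (x 0)⁻¹ = (x 2)⁻¹ * c 1 := by
      rw [mul_inv_eq_iff_eq_mul, mul_inv_eq_iff_eq_mul, eq_comm, mul_assoc, mul_assoc,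
        inv_mul_eq_iff_eq_mul, eq_comm]
      simpa [mul_assoc] using e1
    calc _ = (c 1)⁻¹ * y 2 * (c 1 * x 0 * x 1 * (x 0)⁻¹ * (x 0)⁻¹) := by group
      _ = _ := by rw [e2]; group
  have b3 : y 0 * (x 0)⁻¹ = (c 2 * c 2)⁻¹ * (y 2 * (x 2)⁻¹) * (c 2 * c 2) := by
    rw [← a1]
    calc y 0 * (x 0)⁻¹ = (x 0)⁻¹ * (x 0 * (y 0 * (x 0)⁻¹) * (x 0)⁻¹) * x 0 := by group
      _ = _ := by rw [b2]; group
  have b4 : c 2 * (y 2 * (x 2)⁻¹) = y 1 * (x 1)⁻¹ * c 2 := by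
    have : y 1 * (x 1)⁻¹ * c 2 = (y 1 * c 3) * (x 1 * c 3)⁻¹ * c 2 := by group
    rw [this, a3, a4]; group
  have b5 : (c 2 * c 2)⁻¹ = c 2 * c 2 := by
    rw [inv_eq_iff_mul_eq_one, ← a6]; simp [pow_succ, mul_assoc]
  have b6 : y 0 * (x 0)⁻¹ * c 2 = c 2 * (y 1 * (x 1)⁻¹) := by
    rw [b3, b5]
    calc _ = c 2 * (c 2 * (y 2 * (x 2)⁻¹)) * (c 2 * c 2 * c 2) := by group
      _ = c 2 * (y 1 * (x 1)⁻¹) * (c 2 ^ 4) := by rw [b4]; simp [pow_succ, mul_assoc]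
      _ = _ := by rw [a6, mul_one]
  have b7 : c 3 = (x 0)⁻¹ * c 2 * x 1 := by rw [mul_assoc, ← a5]; group
  calc y 0 * c 3 = y 0 * (x 0)⁻¹ * c 2 * x 1 := by rw [b7]; group
    _ = _ := by rw [b6]; group

theorem y0_c (h : TauRel x y c) {n : ℕ} (hn : 2 ≤ n) : y 0 * c (n + 1) = c n * y 1 := by
  induction n, hn using Nat.le_induction with
  | base => exact h.y0_c_two
  | succ n hn ih =>
    have a1 := h.c_eq (n := n) (by omega)
    have a2 := h.c_eq (n := n + 1) (by omega)
    have a3 := h.xy (i := 0) (j := n) (by omega)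
    have : x n * (y 0 * c (n + 1 + 1)) = x n * (c (n + 1) * y 1) := by
      rw [← mul_assoc, a3, mul_assoc, ← a2, ih, a1, mul_assoc]
    exact mul_left_cancel this

theorem y_c_last (h : TauRel x y c) {n : ℕ} (hn : 2 ≤ n) :
    c n * (y (n + 1))⁻¹ = y n * c (n + 1) := by
  rw [mul_inv_eq_iff_eq_mul]
  induction n, hn using Nat.le_induction with
  | base =>
    have a1 := h.c_y0 (n := 2) (by omega)
    have a2 := h.y_c (k := 1) (n := 2) le_rfl (by omega)
    have a3 := h.y0_c_two
    have a4 := h.c_pow (n := 2) (by omega)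
    have a5 := h.c_pow (n := 3) (by omega)
    norm_num at *
    have e : c 2 ^ 3 * y 2 = (y 3)⁻¹ * c 3 ^ 4 := by
      calc c 2 ^ 3 * y 2 = c 2 * (c 2 * (c 2 * y 2)) := by simp [pow_succ, mul_assoc]
        _ = c 2 * (c 2 * y 1) * c 3 := by rw [← a2]; group
        _ = (y 3)⁻¹ * (y 3 * c 2 * y 0) * c 3 * c 3 := by rw [← a3]; group
        _ = _ := by rw [a1]; simp [pow_succ, mul_assoc]
    have e2 : c 2 ^ 3 = (c 2)⁻¹ := by
      rw [eq_inv_iff_mul_eq_one, ← pow_succ, a4]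
    have e3 : c 3 ^ 4 = (c 3)⁻¹ := by
      rw [eq_inv_iff_mul_eq_one, ← pow_succ, a5]
    rw [e2, e3] at e
    have : y 2 = c 2 * ((y 3)⁻¹ * (c 3)⁻¹) := by rw [← e]; group
    rw [this]; group
  | succ n hn ih =>
    have a1 := h.x0_c (n := n) (by omega)
    have a2 := h.x0_c (n := n + 1) (by omega)
    have a3 := h.yx (i := 0) (j := n) (by omega)
    have a4 := h.yx (i := 1) (j := n + 1) (by omega)
    have : x 0 * c (n + 1) = x 0 * (y (n + 1) * c (n + 1 + 1) * y (n + 1 + 1)) := by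
      calc x 0 * c (n + 1) = y n * c (n + 1) * (y (n + 1) * x 1) := by rw [a1, ih]; group
        _ = y n * (c (n + 1) * x 1) * y (n + 1 + 1) := by rw [a4]; group
        _ = (y n * x 0) * c (n + 1 + 1) * y (n + 1 + 1) := by rw [← a2]; group
        _ = _ := by rw [a3]; group
    exact mul_left_cancel this

theorem st_x (h : TauRel x y c) {i j : ℕ} (hij : i < j) (z w : Bool) :
    tauSt x y z j * tauSt x y w i = tauSt x y w i * tauSt x y z (j + 1) := by
  cases z <;> cases w
  · exact h.yy hij
  · exact h.yx hij
  · exact h.xy hij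
  · exact h.xx hij

theorem c_step_succ (h : TauRel x y c) {n i : ℕ} (hn : 2 ≤ n) (hi : i ≤ n) (z : Bool) :
    c n * tauStep x y n (i + 1) z = tauStep x y n i z * c (n + 1) := by
  rcases hi.lt_or_eq with hi | rfl
  · rcases Nat.eq_zero_or_pos i with rfl | h0
    · cases z <;> simp [tauStep, tauSt, h.x0_c (n := n) (by omega), h.y0_c hn] <;> omega
    · cases z <;>
      simp [tauStep, tauSt, h.x_c h0 hi, h.y_c h0 hi, hi.le, show i + 1 ≤ n from hi]
  · cases z <;> simp [tauStep, tauSt, h.y_c_last hn, ← h.c_eq (n := i) (by omega)]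

theorem c_step_zero (h : TauRel x y c) {n : ℕ} (hn : 2 ≤ n) (z : Bool) :
    c n * tauStep x y n 0 z = tauStep x y n (n + 1) z * c (n + 1) ^ 2 := by
  cases z
  · simp [tauStep, tauSt, pow_two, ← h.c_y0 (n := n) (by omega), mul_assoc]
  · simp [tauStep, tauSt, pow_two, h.c_x0 (n := n) (by omega)]

theorem c_pow_step (h : TauRel x y c) {n : ℕ} (hn : 2 ≤ n) (z : Bool) (k : ℕ) :
    ∀ i, i ≤ n + 1 → ∃ j l, j ≤ n + 1 ∧
      c n ^ k * tauStep x y n i z = tauStep x y n j z * c (n + 1) ^ l := by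
  induction k with
  | zero => exact fun i hi => ⟨i, 0, hi, by simp⟩
  | succ k ih =>
    rintro (_ | i) hi
    · obtain ⟨j, l, hj, e⟩ := ih (n + 1) le_rfl
      refine ⟨j, l + 2, hj, ?_⟩
      rw [pow_succ, mul_assoc, h.c_step_zero hn, ← mul_assoc, e, mul_assoc, pow_add]
    · obtain ⟨j, l, hj, e⟩ := ih i (by omega)
      refine ⟨j, l + 1, hj, ?_⟩
      rw [pow_succ, mul_assoc, h.c_step_succ hn (by omega), ← mul_assoc, e, mul_assoc, pow_succ]

theorem step_comm (h : TauRel x y c) {n i j : ℕ} (hij : i < j) (hj : j ≤ n + 1) (z w : Bool) :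
    tauStep x y n j z * tauStep x y (n + 1) i w =
      tauStep x y n i w * tauStep x y (n + 1) (j + 1) z := by
  rcases hj.lt_or_eq with hj' | rfl
  · simp [tauStep, show j ≤ n by omega, show i ≤ n by omega, show i ≤ n + 1 by omega,
      h.st_x hij]
  · have := h.st_x hij false w
    cases z
    · simp only [tauStep, show i ≤ n by omega, show i ≤ n + 1 by omega, if_true,
        add_le_iff_nonpos_right, nonpos_iff_eq_zero, one_ne_zero, if_false, cond_false]
      rw [inv_mul_eq_iff_eq_mul, ← mul_assoc, eq_mul_inv_iff_mul_eq]
      exact this.symm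
    · simp [tauStep, show i ≤ n by omega, show i ≤ n + 1 by omega]

theorem step_sq (h : TauRel x y c) {n i : ℕ} (hi : i ≤ n + 1) :
    tauStep x y n i false * tauStep x y (n + 1) i false =
      tauStep x y n i true * tauStep x y (n + 1) (i + 1) true := by
  rcases hi.lt_or_eq with hj' | rfl
  · simp [tauStep, show i ≤ n by omega, show i ≤ n + 1 by omega, tauSt, h.y_sq]
  · simp [tauStep, tauSt]

theorem step_diamond (h : TauRel x y c) {n i j : ℕ} (hi : i ≤ n + 1) (hj : j ≤ n + 1)
    (z w : Bool) : tauStep x y n i z = tauStep x y n j w ∨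
      ∃ i' z' j' w', i' ≤ n + 2 ∧ j' ≤ n + 2 ∧
        tauStep x y n i z * tauStep x y (n + 1) i' z' =
          tauStep x y n j w * tauStep x y (n + 1) j' w' := by
  rcases lt_trichotomy i j with hij | rfl | hij
  · exact .inr ⟨j + 1, w, i, z, by omega, by omega, (h.step_comm hij hj w z).symm⟩
  · cases z <;> cases w
    · exact .inl rfl
    · exact .inr ⟨i, false, i + 1, true, by omega, by omega, h.step_sq hi⟩
    · exact .inr ⟨i + 1, true, i, false, by omega, by omega, (h.step_sq hi).symm⟩
    · exact .inl rfl
  · exact .inr ⟨j, w, i + 1, z, by omega, by omega, h.step_comm hij hi z w⟩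

end TauRel

namespace TauPos

variable {G : Type*} [Group G] {x y c : ℕ → G}

theorem le {n m : ℕ} {g : G} (hg : TauPos x y n m g) : n ≤ m := by
  induction hg with
  | nil => exact le_rfl
  | cons _ _ ih => omega

theorem trans {n m l : ℕ} {g g' : G} (hg : TauPos x y n m g) (hg' : TauPos x y m l g') :
    TauPos x y n l (g * g') := by
  induction hg with
  | nil => simpa
  | cons hi _ ih => rw [mul_assoc]; exact cons hi (ih hg')

theorem step {n i : ℕ} (hi : i ≤ n + 1) (z : Bool) :
    TauPos x y n (n + 1) (tauStep x y n i z) := by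
  simpa using cons (z := z) hi (nil (x := x) (y := y) (n + 1))

theorem one {n m : ℕ} (hnm : n ≤ m) : TauPos x y n m 1 := by
  induction m, hnm using Nat.le_induction with
  | base => exact nil n
  | succ m _ ih => simpa [tauStep] using ih.trans (step (i := m + 1) le_rfl true)

theorem strip (h : TauRel x y c) {n b : ℕ} {g : G} (hg : TauPos x y n b g) :
    ∀ {i : ℕ} (z : Bool), i ≤ n + 1 → ∃ m g' k, TauPos x y (n + 1) m g' ∧ TauPos x y b m k ∧
      tauStep x y n i z * g' = g * k := by
  induction hg with
  | nil n => exact fun z hi => ⟨n + 1, 1, _, nil _, step hi z, by simp⟩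
  | @cons n m j w u hj hu ih =>
    intro i z hi
    rcases h.step_diamond hi hj z w with e | ⟨i', z', j', w', hi', hj', e⟩
    · exact ⟨m, u, 1, hu, nil m, by rw [e, mul_one]⟩
    · obtain ⟨m', g', k, h1, h2, e'⟩ := ih w' hj'
      refine ⟨m', _, k, cons (z := z') hi' h1, h2, ?_⟩
      rw [← mul_assoc, e, mul_assoc, e', mul_assoc]

theorem confluent (h : TauRel x y c) {n a : ℕ} {g : G} (hg : TauPos x y n a g) :
    ∀ {b : ℕ} {g₁ : G}, TauPos x y n b g₁ →
      ∃ m k k₁, TauPos x y a m k ∧ TauPos x y b m k₁ ∧ g * k = g₁ * k₁ := by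
  induction hg with
  | nil n => exact fun {b g₁} hg₁ => ⟨b, g₁, 1, hg₁, nil b, by simp⟩
  | cons hi _ ih =>
    intro b g₁ hg₁
    obtain ⟨m, g', k, h1, h2, e⟩ := hg₁.strip h _ hi
    obtain ⟨m', k', k₁', h3, h4, e'⟩ := ih h1
    refine ⟨m', k', k * k₁', h3, h2.trans h4, ?_⟩
    rw [mul_assoc, e', ← mul_assoc, e, mul_assoc]

theorem c_pow_mul (h : TauRel x y c) {n m : ℕ} {g : G} (hg : TauPos x y n m g) :
    2 ≤ n → ∀ k, ∃ g' l, TauPos x y n m g' ∧ c n ^ k * g = g' * c m ^ l := by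
  induction hg with
  | nil n => exact fun _ k => ⟨1, k, nil n, by simp⟩
  | @cons n m i z g hi _ ih =>
    intro hn k
    obtain ⟨j, l, hj, e⟩ := h.c_pow_step hn z k i hi
    obtain ⟨g', l', hg', e'⟩ := ih (by omega) l
    refine ⟨_, l', cons (z := z) hj hg', ?_⟩
    rw [← mul_assoc, e, mul_assoc, e', mul_assoc]

end TauPos

namespace TauRel

variable {G : Type*} [Group G] {x y c : ℕ → G}

theorem inv_c_pow (h : TauRel x y c) {n : ℕ} (hn : 1 ≤ n) (k : ℕ) :
    (c n ^ k)⁻¹ = c n ^ ((n + 1) * k) := by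
  rw [inv_eq_iff_mul_eq_one, ← pow_add, show k + (n + 1) * k = (n + 2) * k by ring, pow_mul,
    h.c_pow hn, one_pow]

/-- The fractions `p * c m ^ k * q⁻¹` form a subgroup. -/
def fractions (h : TauRel x y c) : Subgroup G where
  carrier := {g | ∃ m k p q, TauPos x y 2 m p ∧ TauPos x y 2 m q ∧ g = p * c m ^ k * q⁻¹}
  one_mem' := ⟨2, 0, 1, 1, .nil 2, .nil 2, by simp⟩
  inv_mem' := by
    rintro _ ⟨m, k, p, q, hp, hq, rfl⟩
    refine ⟨m, (m + 1) * k, q, p, hq, hp, ?_⟩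
    rw [← h.inv_c_pow (by have := hp.le; omega) k]
    group
  mul_mem' := by
    rintro _ _ ⟨m, k, p, q, hp, hq, rfl⟩ ⟨n, l, r, s, hr, hs, rfl⟩
    obtain ⟨N, q₁, r₁, hq₁, hr₁, e⟩ := hq.confluent h hr
    obtain ⟨q₂, k', hq₂, e₁⟩ := hq₁.c_pow_mul h hq.le k
    obtain ⟨r₂, l', hr₂, e₂⟩ := hr₁.c_pow_mul h hr.le ((n + 1) * l)
    have hN : 1 ≤ N := by have := hq.le; have := hq₁.le; omega
    refine ⟨N, k' + (N + 1) * l', p * q₂, s * r₂, hp.trans hq₂, hs.trans hr₂, ?_⟩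
    have hqr : q⁻¹ * r = q₁ * r₁⁻¹ := by
      rw [inv_mul_eq_iff_eq_mul, ← mul_assoc, e, mul_inv_cancel_right]
    have hr' : r₁⁻¹ * c n ^ l = (c N ^ l')⁻¹ * r₂⁻¹ := by
      rw [← mul_inv_rev, ← e₂, ← h.inv_c_pow (by have := hr.le; omega)]
      group
    calc p * c m ^ k * q⁻¹ * (r * c n ^ l * s⁻¹)
        = p * c m ^ k * (q⁻¹ * r) * c n ^ l * s⁻¹ := by group
      _ = p * (c m ^ k * q₁) * (r₁⁻¹ * c n ^ l) * s⁻¹ := by rw [hqr]; group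
      _ = p * q₂ * (c N ^ k' * (c N ^ l')⁻¹) * (s * r₂)⁻¹ := by rw [e₁, hr']; group
      _ = _ := by rw [h.inv_c_pow hN, ← pow_add]

theorem st_mem_fractions (h : TauRel x y c) (z : Bool) (n : ℕ) :
    tauSt x y z n ∈ h.fractions :=
  ⟨n + 3, 0, _, 1, (TauPos.one (m := n + 2) (by omega)).trans
    (TauPos.step (i := n) (by omega) z), .one (by omega), by simp [tauStep]⟩

theorem c_mem_fractions (h : TauRel x y c) {n : ℕ} (hn : 1 ≤ n) : c n ∈ h.fractions := by
  have key : ∀ {m}, 2 ≤ m → c m ∈ h.fractions := fun {m} hm =>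
    ⟨m, 1, 1, 1, .one hm, .one hm, by simp⟩
  rcases hn.lt_or_eq with hn | rfl
  · exact key hn
  · rw [h.c_eq le_rfl]
    exact mul_mem (h.st_mem_fractions true 1) (key le_rfl)

end TauRel

/-- An action in which the generators move the points `o k`, the left endpoints of the arcs of
the right vine, as they do on the circle. -/
structure TauAct {G S : Type*} [Group G] [MulAction G S] (x y c : ℕ → G) (o : ℕ → S) :
    Prop where
  inj : Function.Injective o
  st_le : ∀ z {i k}, k ≤ i → tauSt x y z i • o k = o k
  st_lt : ∀ z {i k}, i < k → tauSt x y z i • o (k + 1) = o k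
  c_succ : ∀ {n k}, 1 ≤ n → k ≤ n → c n • o (k + 1) = o k
  c_zero : ∀ {n}, 1 ≤ n → c n • o 0 = o (n + 1)

namespace TauAct

variable {G S : Type*} [Group G] [MulAction G S] {x y c : ℕ → G} {o : ℕ → S}

theorem step_le (ha : TauAct x y c o) {n i k : ℕ} (hi : i ≤ n + 1) (hk : k ≤ i) (z : Bool) :
    tauStep x y n i z • o k = o k := by
  unfold tauStep
  split_ifs with hin
  · exact ha.st_le z hk
  · cases z
    · exact inv_smul_eq_iff.2 (ha.st_le false (i := n + 1) (by omega)).symm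
    · simp

theorem step_lt (ha : TauAct x y c o) {n i k : ℕ} (hk : i < k) (hkn : k ≤ n + 1) (z : Bool) :
    tauStep x y n i z • o (k + 1) = o k := by
  rw [tauStep, if_pos (by omega)]
  exact ha.st_lt z hk

theorem exists_smul_eq (ha : TauAct x y c o) {n m k : ℕ} {g : G} (hg : TauPos x y n m g)
    (hk : k ≤ n + 1) : ∃ l ≤ m + 1, g • o l = o k := by
  induction hg generalizing k with
  | nil => exact ⟨k, hk, by simp⟩
  | @cons n m i z g hi hg ih =>
    by_cases hki : k ≤ i
    · obtain ⟨l, hl, e⟩ := ih (k := k) (by omega)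
      exact ⟨l, hl, by rw [mul_smul, e, ha.step_le hi hki]⟩
    · obtain ⟨l, hl, e⟩ := ih (k := k + 1) (by omega)
      exact ⟨l, hl, by rw [mul_smul, e, ha.step_lt (by omega) hk]⟩

theorem exists_factor (h : TauRel x y c) (ha : TauAct x y c o) {n m : ℕ} {g : G}
    (hg : TauPos x y n m g) : ∀ {j : ℕ} (w : Bool), j ≤ n + 1 →
      (∃ l ≤ m + 1, g • o l = tauStep x y n j w • o (j + 1)) →
        ∃ g', TauPos x y (n + 1) m g' ∧ g = tauStep x y n j w * g' := by
  induction hg with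
  | nil n =>
    rintro j w hj ⟨l, hl, e⟩
    rw [one_smul] at e
    by_cases hlj : l ≤ j
    · rw [← ha.step_le hj hlj w] at e
      have := ha.inj (MulAction.injective _ e)
      omega
    · rw [← ha.step_lt (i := j) (by omega) hl w] at e
      have := ha.inj (MulAction.injective _ e)
      omega
  | @cons n m i z u hi hu ih =>
    rintro j w hj ⟨l, hl, e⟩
    have key : ∀ {j' w' i' z'}, j' ≤ n + 2 → i' ≤ n + 2 →
        tauStep x y n i z * tauStep x y (n + 1) j' w' =
          tauStep x y n j w * tauStep x y (n + 1) i' z' →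
        tauStep x y n j w • o (j + 1) =
          tauStep x y n i z • tauStep x y (n + 1) j' w' • o (j' + 1) →
        ∃ g', TauPos x y (n + 1) m g' ∧ tauStep x y n i z * u = tauStep x y n j w * g' := by
      intro j' w' i' z' hj' hi' e₁ e₂
      rw [e₂, mul_smul] at e
      obtain ⟨g', hg', rfl⟩ := ih w' hj' ⟨l, hl, MulAction.injective _ e⟩
      exact ⟨_, .cons (z := z') hi' hg', by rw [← mul_assoc, e₁, mul_assoc]⟩
    rcases lt_trichotomy i j with hij | rfl | hij
    · have e₁ := h.step_comm hij hj w z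
      refine key (j' := j + 1) (w' := w) (i' := i) (z' := z) (by omega) (by omega) e₁.symm ?_
      rw [← mul_smul, ← e₁, mul_smul, ha.step_lt (i := i) (k := j + 1) (by omega) (by omega)]
    · by_cases hzw : z = w
      · subst hzw
        exact ⟨u, hu, rfl⟩
      · have e₁ := h.step_sq hi
        cases z <;> cases w <;> first | exact absurd rfl hzw | skip
        · refine key (j' := i) (w' := false) (i' := i + 1) (z' := true) (by omega) (by omega)
            e₁ ?_
          rw [← mul_smul, e₁, mul_smul, ha.step_le (i := i + 1) (by omega) le_rfl]
        · refine key (j' := i + 1) (w' := true) (i' := i) (z' := false) (by omega) (by omega)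
            e₁.symm ?_
          rw [← mul_smul, ← e₁, mul_smul, ha.step_lt (i := i) (k := i + 1) (by omega) (by omega)]
    · have e₁ := h.step_comm hij hi z w
      refine key (j' := j) (w' := w) (i' := i + 1) (z' := z) (by omega) (by omega) e₁ ?_
      rw [← mul_smul, e₁, mul_smul, ha.step_le (i := i + 1) (by omega) (by omega)]

theorem eq_of_smul (h : TauRel x y c) (ha : TauAct x y c o) {n m : ℕ} {p : G}
    (hp : TauPos x y n m p) : ∀ {q : G}, TauPos x y n m q →
      (∀ k ≤ m + 1, ∃ l ≤ m + 1, q • o l = p • o k) → p = q := by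
  induction hp with
  | nil n =>
    intro q hq _
    cases hq with
    | nil => rfl
    | cons _ hg => have := hg.le; omega
  | @cons n m i z u hi hu ih =>
    intro q hq H
    obtain ⟨k, hk, e⟩ := ha.exists_smul_eq hu (k := i + 1) (by omega)
    obtain ⟨l, hl, e'⟩ := H k hk
    rw [mul_smul, e] at e'
    obtain ⟨q', hq', rfl⟩ := ha.exists_factor h hq z hi ⟨l, hl, e'⟩
    rw [ih hq' fun k hk => ?_]
    obtain ⟨l, hl, e⟩ := H k hk
    rw [mul_smul, mul_smul] at e
    exact ⟨l, hl, MulAction.injective _ e⟩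

theorem c_pow_smul (ha : TauAct x y c o) {n : ℕ} (hn : 1 ≤ n) (k : ℕ) :
    ∀ {i}, i ≤ n + 1 → ∃ j ≤ n + 1, c n ^ k • o i = o j := by
  induction k with
  | zero => exact fun {i} hi => ⟨i, hi, by simp⟩
  | succ k ih =>
    rintro (_ | i) hi
    · rw [pow_succ, mul_smul, ha.c_zero hn]
      exact ih le_rfl
    · rw [pow_succ, mul_smul, ha.c_succ hn (by omega)]
      exact ih (by omega)

theorem c_pow_smul_self (ha : TauAct x y c o) {n : ℕ} (hn : 1 ≤ n) :
    ∀ k, k ≤ n + 1 → c n ^ k • o k = o 0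
  | 0, _ => by simp
  | k + 1, hk => by
      rw [pow_succ, mul_smul, ha.c_succ hn (by omega), c_pow_smul_self ha hn k (by omega)]

theorem exists_smul_zero (ha : TauAct x y c o) (k : ℕ) : ∃ g : G, g • o 0 = o k := by
  refine ⟨(c (k + 1) ^ k)⁻¹, ?_⟩
  rw [inv_smul_eq_iff, ha.c_pow_smul_self (by omega) k (by omega)]

theorem eq_one (h : TauRel x y c) (ha : TauAct x y c o) {g : G} (hg : g ∈ h.fractions)
    (H : ∀ t : G, g • t • o 0 = t • o 0) : g = 1 := by
  obtain ⟨m, k, p, q, hp, hq, rfl⟩ := hg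
  have hm : 1 ≤ m := by have := hp.le; omega
  have H' : ∀ i, p • c m ^ k • o i = q • o i := fun i => by
    obtain ⟨t, ht⟩ := ha.exists_smul_zero i
    have := H (q * t)
    rw [mul_smul q, ht, ← mul_smul, inv_mul_cancel_right, mul_smul] at this
    exact this
  have hpq : q = p := by
    refine ha.eq_of_smul h hq hp fun i hi => ?_
    obtain ⟨j, hj, e⟩ := ha.c_pow_smul hm k hi
    exact ⟨j, hj, by rw [← e, H']⟩
  subst hpq
  have hc : c m ^ k = c m ^ (k % (m + 2)) := by
    conv_lhs => rw [← Nat.mod_add_div k (m + 2), pow_add, pow_mul, h.c_pow hm, one_pow, mul_one]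
  have hk : k % (m + 2) = 0 := by
    have h1 := Nat.mod_lt k (show m + 2 > 0 by omega)
    have h2 := MulAction.injective _ (H' (k % (m + 2)))
    rw [hc, ha.c_pow_smul_self hm _ (by omega)] at h2
    exact (ha.inj h2).symm
  rw [hc, hk]
  simp

end TauAct

/-- The circle of unit length, cut open at `0`. -/
abbrev TauCirc : Type := Set.Ico (0 : ℝ) 1

namespace TauCirc

/-- The inverse of the golden ratio. -/
def tau : ℝ := -Real.goldenConj

theorem tau_sq : tau ^ 2 = 1 - tau := by
  rw [tau, neg_sq, Real.goldenConj_sq]; ring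

theorem tau_pos : 0 < tau := neg_pos.2 Real.goldenConj_neg

theorem tau_lt_one : tau < 1 := neg_lt.1 Real.neg_one_lt_goldenConj

/-- The homothety of ratio `τ` fixing the left end of the interval. -/
def P (u : TauCirc) : TauCirc :=
  ⟨tau * u, mul_nonneg tau_pos.le u.2.1, by nlinarith [u.2.1, u.2.2, tau_pos, tau_lt_one]⟩

/-- The homothety of ratio `τ` fixing the right end of the interval. -/
def Q (u : TauCirc) : TauCirc :=
  ⟨1 - tau * (1 - u), by nlinarith [u.2.1, u.2.2, tau_pos, tau_lt_one],
    by nlinarith [u.2.1, u.2.2, tau_pos, tau_lt_one]⟩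

theorem P_lt_P {u v : TauCirc} : P u < P v ↔ u < v := by
  simp only [P, ← Subtype.coe_lt_coe]
  exact mul_lt_mul_iff_right₀ tau_pos

theorem Q_lt_Q {u v : TauCirc} : Q u < Q v ↔ u < v := by
  simp only [Q, ← Subtype.coe_lt_coe, sub_lt_sub_iff_left, mul_lt_mul_iff_right₀ tau_pos]

theorem strictMono_P : StrictMono P := fun _ _ => P_lt_P.2

theorem strictMono_Q : StrictMono Q := fun _ _ => Q_lt_Q.2

theorem Q_inj {u v : TauCirc} : Q u = Q v ↔ u = v := strictMono_Q.injective.eq_iff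

theorem PP_lt_Q (u v : TauCirc) : P (P u) < Q v := by
  simp only [P, Q, ← Subtype.coe_lt_coe]
  nlinarith [u.2.2, v.2.1, tau_pos, tau_sq, mul_nonneg tau_pos.le v.2.1,
    mul_pos (mul_pos tau_pos tau_pos) (sub_pos.2 u.2.2)]

theorem not_Q_lt_PP (u v : TauCirc) : ¬ Q u < P (P v) := (PP_lt_Q v u).not_gt

theorem P_lt_QQ (u v : TauCirc) : P u < Q (Q v) := by
  simp only [P, Q, ← Subtype.coe_lt_coe]
  nlinarith [u.2.2, v.2.1, tau_pos, tau_sq, mul_nonneg (mul_pos tau_pos tau_pos).le v.2.1,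
    mul_pos tau_pos (sub_pos.2 u.2.2)]

theorem PQQ (u : TauCirc) : P (Q (Q u)) = Q (P (P u)) := by
  ext
  simp only [P, Q]
  linear_combination (1 - tau) * tau_sq

theorem PP_or_Q (u : TauCirc) : (∃ v, u = P (P v)) ∨ ∃ v, u = Q v := by
  rcases lt_or_ge (u : ℝ) (tau ^ 2) with h | h
  · refine .inl ⟨⟨u / tau ^ 2, div_nonneg u.2.1 (sq_nonneg _),
      (div_lt_one (pow_pos tau_pos 2)).2 h⟩, ?_⟩
    ext
    simp only [P]
    field_simp [tau_pos.ne']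
  · refine .inr ⟨⟨1 - (1 - u) / tau, ?_, ?_⟩, ?_⟩
    · rw [sub_nonneg, div_le_one tau_pos]; linarith [tau_sq]
    · have := div_pos (sub_pos.2 u.2.2) tau_pos; linarith
    · ext
      simp only [Q]
      field_simp [tau_pos.ne']
      ring

theorem P_or_QQ (u : TauCirc) : (∃ v, u = P v) ∨ ∃ v, u = Q (Q v) := by
  rcases PP_or_Q u with ⟨v, rfl⟩ | ⟨v, rfl⟩
  · exact .inl ⟨_, rfl⟩
  · rcases PP_or_Q v with ⟨w, rfl⟩ | ⟨w, rfl⟩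
    · exact .inl ⟨_, (PQQ w).symm⟩
    · exact .inr ⟨_, rfl⟩

/-- The caret cutting the interval into a short and a long piece. -/
def caretX : TauCirc ⊕ TauCirc ≃ TauCirc :=
  Equiv.ofBijective (Sum.elim (fun u => P (P u)) Q) <| by
    refine ⟨(strictMono_P.comp strictMono_P).injective.sumElim strictMono_Q.injective
      fun u v => (PP_lt_Q u v).ne, fun u => ?_⟩
    rcases PP_or_Q u with ⟨v, rfl⟩ | ⟨v, rfl⟩
    exacts [⟨.inl v, rfl⟩, ⟨.inr v, rfl⟩]

/-- The caret cutting the interval into a long and a short piece. -/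
def caretY : TauCirc ⊕ TauCirc ≃ TauCirc :=
  Equiv.ofBijective (Sum.elim P (fun u => Q (Q u))) <| by
    refine ⟨strictMono_P.injective.sumElim (strictMono_Q.comp strictMono_Q).injective
      fun u v => (P_lt_QQ u v).ne, fun u => ?_⟩
    rcases P_or_QQ u with ⟨v, rfl⟩ | ⟨v, rfl⟩
    exacts [⟨.inl v, rfl⟩, ⟨.inr v, rfl⟩]

@[simp] theorem caretX_symm_PP (u : TauCirc) : caretX.symm (P (P u)) = .inl u :=
  caretX.symm_apply_eq.2 rfl

@[simp] theorem caretX_symm_Q (u : TauCirc) : caretX.symm (Q u) = .inr u :=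
  caretX.symm_apply_eq.2 rfl

@[simp] theorem caretX_inl (u : TauCirc) : caretX (.inl u) = P (P u) := rfl

@[simp] theorem caretX_inr (u : TauCirc) : caretX (.inr u) = Q u := rfl

@[simp] theorem caretY_symm_P (u : TauCirc) : caretY.symm (P u) = .inl u :=
  caretY.symm_apply_eq.2 rfl

@[simp] theorem caretY_symm_QQ (u : TauCirc) : caretY.symm (Q (Q u)) = .inr u :=
  caretY.symm_apply_eq.2 rfl

/-- The conjugate of a permutation acting on the right piece of the first caret. -/
def lift : Equiv.Perm TauCirc →* Equiv.Perm TauCirc where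
  toFun f := (caretX.symm.trans (Equiv.sumCongr (Equiv.refl _) f)).trans caretX
  map_one' := by ext u; rcases PP_or_Q u with ⟨v, rfl⟩ | ⟨v, rfl⟩ <;> simp
  map_mul' f g := by ext u; rcases PP_or_Q u with ⟨v, rfl⟩ | ⟨v, rfl⟩ <;> simp

@[simp] theorem lift_PP (f : Equiv.Perm TauCirc) (u : TauCirc) :
    lift f (P (P u)) = P (P u) := by simp [lift]

@[simp] theorem lift_Q (f : Equiv.Perm TauCirc) (u : TauCirc) :
    lift f (Q u) = Q (f u) := by simp [lift]

/-- The action of `y 0`. -/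
def y₀ : Equiv.Perm TauCirc := caretY.symm.trans caretX

/-- The action of `x 0`. -/
def x₀ : Equiv.Perm TauCirc :=
  ((((caretX.symm.trans (Equiv.sumCongr (Equiv.refl _) caretX.symm)).trans
    (Equiv.sumAssoc _ _ _).symm).trans (Equiv.sumCongr caretX (Equiv.refl _)))).trans caretX

/-- The exchange of the two pieces of the first caret. -/
def c₀ : Equiv.Perm TauCirc := (caretX.symm.trans (Equiv.sumComm _ _)).trans caretX

@[simp] theorem y₀_P (u : TauCirc) : y₀ (P u) = P (P u) := by simp [y₀]

@[simp] theorem y₀_QQ (u : TauCirc) : y₀ (Q (Q u)) = Q u := by simp [y₀]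

@[simp] theorem x₀_PP (u : TauCirc) : x₀ (P (P u)) = P (P (P (P u))) := by simp [x₀]

@[simp] theorem x₀_QPP (u : TauCirc) : x₀ (Q (P (P u))) = P (P (Q u)) := by simp [x₀]

@[simp] theorem x₀_QQ (u : TauCirc) : x₀ (Q (Q u)) = Q u := by simp [x₀]

@[simp] theorem c₀_PP (u : TauCirc) : c₀ (P (P u)) = Q u := by simp [c₀]

@[simp] theorem c₀_Q (u : TauCirc) : c₀ (Q u) = P (P u) := by simp [c₀]

/-- The action of `x n`. -/
def xs : ℕ → Equiv.Perm TauCirc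
  | 0 => x₀
  | n + 1 => lift (xs n)

/-- The action of `y n`. -/
def ys : ℕ → Equiv.Perm TauCirc
  | 0 => y₀
  | n + 1 => lift (ys n)

/-- The action of `c n`. -/
def cs : ℕ → Equiv.Perm TauCirc
  | 0 => c₀
  | n + 1 => (xs n)⁻¹ * cs n

theorem lift_mul_x₀ (f : Equiv.Perm TauCirc) : lift f * x₀ = x₀ * lift (lift f) := by
  ext1 u
  rcases PP_or_Q u with ⟨u, rfl⟩ | ⟨u, rfl⟩
  · simp
  · rcases PP_or_Q u with ⟨u, rfl⟩ | ⟨u, rfl⟩ <;> simp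

theorem lift_mul_y₀ (f : Equiv.Perm TauCirc) : lift f * y₀ = y₀ * lift (lift f) := by
  ext1 u
  rcases P_or_QQ u with ⟨u, rfl⟩ | ⟨u, rfl⟩
  · rcases P_or_QQ u with ⟨u, rfl⟩ | ⟨u, rfl⟩
    · simp
    · rw [Equiv.Perm.mul_apply, Equiv.Perm.mul_apply, y₀_P, lift_PP, PQQ, lift_Q, lift_PP, ← PQQ,
        y₀_P]
  · simp

theorem st_succ (z : Bool) (n : ℕ) : tauSt xs ys z (n + 1) = lift (tauSt xs ys z n) := by
  cases z <;> rfl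

theorem st_mul_st (z w : Bool) : ∀ {i j : ℕ}, i < j →
    tauSt xs ys z j * tauSt xs ys w i = tauSt xs ys w i * tauSt xs ys z (j + 1) := by
  intro i
  induction i with
  | zero =>
    rintro (_ | j) hj
    · omega
    · rw [st_succ z (j + 1), st_succ z j]
      cases w
      · exact lift_mul_y₀ _
      · exact lift_mul_x₀ _
  | succ i ih =>
    rintro (_ | j) hj
    · omega
    · rw [st_succ z (j + 1), st_succ z j, st_succ w i, ← map_mul, ih (by omega), map_mul, st_succ z j]

theorem ys_sq (n : ℕ) : ys n * ys n = xs n * xs (n + 1) := by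
  induction n with
  | zero =>
    ext1 u
    simp only [ys, xs, Equiv.Perm.mul_apply]
    rcases P_or_QQ u with ⟨u, rfl⟩ | ⟨u, rfl⟩
    · rcases P_or_QQ u with ⟨u, rfl⟩ | ⟨u, rfl⟩
      · simp
      · rw [y₀_P, y₀_P, PQQ, lift_Q, x₀_PP, x₀_QPP]
    · rcases PP_or_Q u with ⟨u, rfl⟩ | ⟨u, rfl⟩
      · rw [lift_Q, x₀_QPP, x₀_QPP, y₀_QQ, ← PQQ, y₀_P]
      · simp
  | succ n ih => simp only [ys, xs] at ih ⊢; rw [← map_mul, ih, map_mul]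

theorem cs_eq (n : ℕ) : cs n = xs n * cs (n + 1) := by simp [cs]

theorem cs_eq_of_xs {n : ℕ} {u v : TauCirc} (h : cs n u = xs n v) : cs (n + 1) u = v :=
  (xs n).symm_apply_eq.2 h

theorem cs_zero : cs 0 = c₀ := rfl

@[simp] theorem cs_one_PP (u : TauCirc) : cs 1 (P (P u)) = Q (Q u) :=
  cs_eq_of_xs (by simp [cs_zero, xs])

@[simp] theorem cs_one_QPP (u : TauCirc) : cs 1 (Q (P (P u))) = P (P u) :=
  cs_eq_of_xs (by simp [cs_zero, xs])

@[simp] theorem cs_one_QQ (u : TauCirc) : cs 1 (Q (Q u)) = Q (P (P u)) :=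
  cs_eq_of_xs (by simp [cs_zero, xs])

@[simp] theorem cs_two_PP (u : TauCirc) : cs 2 (P (P u)) = Q (Q (Q u)) :=
  cs_eq_of_xs (by simp [xs])

@[simp] theorem cs_two_QPP (u : TauCirc) : cs 2 (Q (P (P u))) = P (P u) :=
  cs_eq_of_xs (by simp [xs])

@[simp] theorem cs_two_QQPP (u : TauCirc) : cs 2 (Q (Q (P (P u)))) = Q (P (P u)) :=
  cs_eq_of_xs (by simp [xs])

@[simp] theorem cs_two_QQQ (u : TauCirc) : cs 2 (Q (Q (Q u))) = Q (Q (P (P u))) :=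
  cs_eq_of_xs (by simp [xs])

@[simp] theorem cs_three_PP (u : TauCirc) : cs 3 (P (P u)) = Q (Q (Q (Q u))) :=
  cs_eq_of_xs (by simp [xs])

@[simp] theorem cs_three_QPP (u : TauCirc) : cs 3 (Q (P (P u))) = P (P u) :=
  cs_eq_of_xs (by simp [xs])

@[simp] theorem cs_three_QQPP (u : TauCirc) : cs 3 (Q (Q (P (P u)))) = Q (P (P u)) :=
  cs_eq_of_xs (by simp [xs])

@[simp] theorem cs_three_QQQPP (u : TauCirc) :
    cs 3 (Q (Q (Q (P (P u))))) = Q (Q (P (P u))) :=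
  cs_eq_of_xs (by simp [xs])

@[simp] theorem cs_three_QQQQ (u : TauCirc) : cs 3 (Q (Q (Q (Q u)))) = Q (Q (Q (P (P u)))) :=
  cs_eq_of_xs (by simp [xs])

theorem x0_c1 : xs 0 * cs 2 = cs 1 * xs 1 := by
  ext1 u
  rcases PP_or_Q u with ⟨u, rfl⟩ | ⟨u, rfl⟩
  · simp [xs]
  rcases PP_or_Q u with ⟨u, rfl⟩ | ⟨u, rfl⟩
  · simp [xs]
  rcases PP_or_Q u with ⟨u, rfl⟩ | ⟨u, rfl⟩ <;> simp [xs]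

theorem x1_c2 : xs 1 * cs 3 = cs 2 * xs 2 := by
  ext1 u
  rcases PP_or_Q u with ⟨u, rfl⟩ | ⟨u, rfl⟩
  · simp [xs]
  rcases PP_or_Q u with ⟨u, rfl⟩ | ⟨u, rfl⟩
  · simp [xs]
  rcases PP_or_Q u with ⟨u, rfl⟩ | ⟨u, rfl⟩
  · simp [xs]
  rcases PP_or_Q u with ⟨u, rfl⟩ | ⟨u, rfl⟩ <;> simp [xs]

theorem y1_c2 : ys 1 * cs 3 = cs 2 * ys 2 := by
  ext1 u
  rcases PP_or_Q u with ⟨u, rfl⟩ | ⟨u, rfl⟩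
  · simp [ys]
  rcases PP_or_Q u with ⟨u, rfl⟩ | ⟨u, rfl⟩
  · simp [ys]
  rcases P_or_QQ u with ⟨u, rfl⟩ | ⟨u, rfl⟩
  · rcases P_or_QQ u with ⟨u, rfl⟩ | ⟨u, rfl⟩
    · simp [ys]
    · have h1 : lift (lift y₀) (Q (Q (P (Q (Q u))))) = Q (Q (P (P (Q (Q u))))) := by
        rw [lift_Q, lift_Q, y₀_P]
      have h2 : cs 3 (Q (Q (P (Q (Q u))))) = Q (Q (P (P u))) := by rw [PQQ, cs_three_QQQPP]
      have h3 : lift y₀ (Q (Q (P (P u)))) = Q (P (P (Q (Q u)))) := by rw [lift_Q, ← PQQ, y₀_P]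
      simp only [ys, Equiv.Perm.mul_apply, h1, h2, h3, cs_two_QQPP]
  · simp [ys]

theorem c0_x0 : cs 0 * xs 0 = cs 1 * cs 1 := by
  ext1 u
  rcases PP_or_Q u with ⟨u, rfl⟩ | ⟨u, rfl⟩
  · simp [xs, cs_zero]
  rcases PP_or_Q u with ⟨u, rfl⟩ | ⟨u, rfl⟩ <;> simp [xs, cs_zero]

theorem c0_y0 : ys 1 * cs 0 * ys 0 = cs 1 * cs 1 := by
  ext1 u
  rcases P_or_QQ u with ⟨u, rfl⟩ | ⟨u, rfl⟩
  · rcases P_or_QQ u with ⟨u, rfl⟩ | ⟨u, rfl⟩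
    · simp [ys, cs_zero]
    · have h1 : cs 1 (cs 1 (P (Q (Q u)))) = Q (Q u) := by rw [PQQ, cs_one_QPP, cs_one_PP]
      simp only [ys, Equiv.Perm.mul_apply, y₀_P, cs_zero, c₀_PP, lift_Q, y₀_QQ, h1]
  · simp [ys, cs_zero]

theorem c0_sq : cs 0 * cs 0 = 1 := by
  ext1 u
  rcases PP_or_Q u with ⟨u, rfl⟩ | ⟨u, rfl⟩ <;> simp [cs_zero]

theorem st_c_step {z : Bool} {k n : ℕ} (hk : k < n) {b : Equiv.Perm TauCirc}
    (h : tauSt xs ys z k * cs (n + 1) = cs n * b) :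
    tauSt xs ys z k * cs (n + 2) = cs (n + 1) * b := by
  have h1 : xs n * tauSt xs ys z k = tauSt xs ys z k * xs (n + 1) := st_mul_st true z hk
  rw [← mul_right_inj (xs n), ← mul_assoc, h1, mul_assoc, ← cs_eq, h, ← mul_assoc, ← cs_eq]

theorem x0_c {n : ℕ} (hn : 1 ≤ n) : xs 0 * cs (n + 1) = cs n * xs 1 := by
  induction n, hn using Nat.le_induction with
  | base => exact x0_c1
  | succ n hn ih => exact st_c_step (z := true) hn ih

theorem st_c_one (z : Bool) {n : ℕ} (hn : 2 ≤ n) :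
    tauSt xs ys z 1 * cs (n + 1) = cs n * tauSt xs ys z 2 := by
  induction n, hn using Nat.le_induction with
  | base =>
    cases z
    exacts [y1_c2, x1_c2]
  | succ n hn ih => exact st_c_step hn ih

theorem st_c (z : Bool) {k n : ℕ} (hk : 1 ≤ k) (hn : k < n) :
    tauSt xs ys z k * cs (n + 1) = cs n * tauSt xs ys z (k + 1) := by
  induction k, hk using Nat.le_induction generalizing n with
  | base => exact st_c_one z hn
  | succ k hk ih =>
    obtain ⟨m, rfl⟩ : ∃ m, n = m + 1 := ⟨n - 1, by omega⟩
    have h1 : tauSt xs ys z k * xs 0 = xs 0 * tauSt xs ys z (k + 1) := st_mul_st z true hk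
    have h2 : tauSt xs ys z (k + 1) * xs 1 = xs 1 * tauSt xs ys z (k + 2) :=
      st_mul_st z true (i := 1) (by omega)
    rw [← mul_right_inj (xs 0), ← mul_assoc, ← h1, mul_assoc, x0_c (by omega), ← mul_assoc,
      ih (by omega), mul_assoc, h2, ← mul_assoc, ← x0_c (by omega), mul_assoc]

theorem x_c {k n : ℕ} (hn : k < n) : xs k * cs (n + 1) = cs n * xs (k + 1) := by
  rcases Nat.eq_zero_or_pos k with rfl | hk
  · exact x0_c hn
  · exact st_c true hk hn

theorem c_x0 (n : ℕ) : cs n * xs 0 = cs (n + 1) * cs (n + 1) := by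
  induction n with
  | zero => exact c0_x0
  | succ n ih =>
    rw [← mul_right_inj (xs n), ← mul_assoc, ← cs_eq, ih, ← mul_assoc, x_c n.lt_succ_self,
      mul_assoc, ← cs_eq]

theorem c_y0 (n : ℕ) : ys (n + 1) * cs n * ys 0 = cs (n + 1) * cs (n + 1) := by
  induction n with
  | zero => exact c0_y0
  | succ n ih =>
    have h1 : ys (n + 1) * xs n = xs n * ys (n + 2) := st_mul_st false true n.lt_succ_self
    rw [← mul_right_inj (xs n), ← mul_assoc, ← mul_assoc, ← h1, mul_assoc (ys _), ← cs_eq, ih,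
      ← mul_assoc (xs n), x_c n.lt_succ_self, mul_assoc, ← cs_eq]

theorem c_pow_succ (n : ℕ) :
    ∀ k, k ≤ n → cs n ^ (k + 1) = xs (n - k) * cs (n + 1) ^ (k + 1)
  | 0, _ => by simpa using cs_eq n
  | k + 1, hk => by
      rw [pow_succ', c_pow_succ n k (by omega), ← mul_assoc,
        show n - k = n - (k + 1) + 1 by omega, ← x_c (by omega), mul_assoc, ← pow_succ']

theorem c_pow (n : ℕ) : cs n ^ (n + 2) = 1 := by
  induction n with
  | zero => rw [pow_two, c0_sq]
  | succ n ih =>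
    rw [← ih, pow_succ' (cs n), c_pow_succ n n le_rfl, Nat.sub_self, ← mul_assoc, c_x0, mul_assoc,
      ← pow_succ', ← pow_succ']

theorem tauRel : TauRel xs ys cs where
  xx := st_mul_st true true
  xy := st_mul_st true false
  yx := st_mul_st false true
  yy := st_mul_st false false
  y_sq := ys_sq
  x_c _ hn := x_c hn
  y_c := st_c false
  c_x0 _ := c_x0 _
  c_eq _ := cs_eq _
  c_pow _ := c_pow _
  c_y0 _ := c_y0 _

/-- The point at which the circle is cut. -/
def base : TauCirc := ⟨0, le_rfl, zero_lt_one⟩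

theorem P_base : P base = base := by ext; simp [P, base]

theorem base_le (u : TauCirc) : base ≤ u := u.2.1

/-- The left endpoints of the pieces of the infinite right vine. -/
def o (k : ℕ) : TauCirc := Q^[k] base

theorem o_zero : o 0 = base := rfl

theorem o_succ (k : ℕ) : o (k + 1) = Q (o k) := Function.iterate_succ_apply' _ _ _

theorem base_lt_Q (u : TauCirc) : base < Q u := by
  simpa only [P_base] using PP_lt_Q base u

theorem o_injective : Function.Injective o := by
  intro i
  induction i with
  | zero =>
    rintro (_ | j) h
    · rfl
    · exact absurd h (by rw [o_zero, o_succ]; exact (base_lt_Q _).ne)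
  | succ i ih =>
    rintro (_ | j) h
    · exact absurd h (by rw [o_zero, o_succ]; exact (base_lt_Q _).ne')
    · rw [o_succ, o_succ, Q_inj] at h
      rw [ih h]

theorem st_o_le (z : Bool) : ∀ {i k : ℕ}, k ≤ i → tauSt xs ys z i (o k) = o k := by
  intro i
  induction i with
  | zero =>
    intro k hk
    obtain rfl : k = 0 := by omega
    have h1 : x₀ base = base := by simpa only [P_base] using x₀_PP base
    have h2 : y₀ base = base := by simpa only [P_base] using y₀_P base
    cases z
    exacts [h2, h1]
  | succ i ih =>
    rintro (_ | k) hk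
    · rw [st_succ, o_zero]
      simpa only [P_base] using lift_PP (tauSt xs ys z i) base
    · rw [st_succ, o_succ, lift_Q, ih (by omega)]

theorem st_o_lt (z : Bool) : ∀ {i k : ℕ}, i < k → tauSt xs ys z i (o (k + 1)) = o k := by
  intro i
  induction i with
  | zero =>
    rintro (_ | k) hk
    · omega
    · rw [o_succ, o_succ]
      cases z
      exacts [y₀_QQ _, x₀_QQ _]
  | succ i ih =>
    rintro (_ | k) hk
    · omega
    · rw [st_succ, o_succ, lift_Q, ih (by omega), o_succ]

theorem cs_o_zero (n : ℕ) : cs n (o 0) = o (n + 1) := by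
  induction n with
  | zero =>
    rw [cs_zero, o_succ, o_zero]
    simpa only [P_base] using c₀_PP base
  | succ n ih => exact cs_eq_of_xs (by rw [ih]; exact (st_o_lt true n.lt_succ_self).symm)

theorem xs_iterate_Q (n : ℕ) (u : TauCirc) : xs n (Q^[n] u) = Q^[n] (x₀ u) := by
  induction n with
  | zero => rfl
  | succ n ih => rw [xs, Function.iterate_succ_apply', lift_Q, ih, Function.iterate_succ_apply']

theorem cs_iterate_Q (n : ℕ) (u : TauCirc) : cs n (Q^[n + 1] u) = Q^[n] (P (P u)) := by
  induction n generalizing u with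
  | zero => exact c₀_Q u
  | succ n ih =>
    exact cs_eq_of_xs (by
      rw [Function.iterate_succ_apply, ih, Function.iterate_succ_apply, xs_iterate_Q, x₀_QPP])

theorem cs_o_succ {n k : ℕ} (hk : k ≤ n) : cs n (o (k + 1)) = o k := by
  induction n with
  | zero =>
    obtain rfl : k = 0 := by omega
    rw [cs_zero, o_succ, o_zero]
    simpa only [P_base] using c₀_Q base
  | succ n ih =>
    rcases hk.lt_or_eq with hk | rfl
    · exact cs_eq_of_xs (by rw [ih (by omega)]; exact (st_o_le true (by omega)).symm)
    · rw [o, o]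
      simpa only [P_base] using cs_iterate_Q (n + 1) base

/-- The strict cyclic order of the circle. -/
def Cyc (a b c : TauCirc) : Prop := a < b ∧ b < c ∨ b < c ∧ c < a ∨ c < a ∧ a < b

/-- The permutations of the circle preserving its cyclic order. -/
def cycSubgroup : Subgroup (Equiv.Perm TauCirc) where
  carrier := {f | ∀ a b c, Cyc (f a) (f b) (f c) ↔ Cyc a b c}
  one_mem' _ _ _ := Iff.rfl
  mul_mem' hf hg a b c := (hf _ _ _).trans (hg a b c)
  inv_mem' {f} hf a b c := by
    have := hf (f⁻¹ a) (f⁻¹ b) (f⁻¹ c)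
    simpa using this.symm

theorem mem_cycSubgroup_of_strictMono {f : Equiv.Perm TauCirc} (hf : StrictMono f) :
    f ∈ cycSubgroup := fun a b c => by simp only [Cyc, hf.lt_iff_lt]

theorem strictMono_lift {f : Equiv.Perm TauCirc} (hf : StrictMono f) : StrictMono (lift f) := by
  intro a b hab
  rcases PP_or_Q a with ⟨a, rfl⟩ | ⟨a, rfl⟩ <;> rcases PP_or_Q b with ⟨b, rfl⟩ | ⟨b, rfl⟩
  · simpa using hab
  · simpa using PP_lt_Q _ _
  · exact absurd hab (not_Q_lt_PP _ _)
  · simpa [Q_lt_Q, hf.lt_iff_lt] using hab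

theorem strictMono_y₀ : StrictMono y₀ := by
  intro a b hab
  rcases P_or_QQ a with ⟨a, rfl⟩ | ⟨a, rfl⟩ <;> rcases P_or_QQ b with ⟨b, rfl⟩ | ⟨b, rfl⟩
  · simpa [P_lt_P] using hab
  · simpa using PP_lt_Q _ _
  · exact absurd hab (P_lt_QQ _ _).not_gt
  · simpa [Q_lt_Q] using hab

theorem strictMono_ys (n : ℕ) : StrictMono (ys n) := by
  induction n with
  | zero => exact strictMono_y₀
  | succ n ih => exact strictMono_lift ih

theorem ys_mem (n : ℕ) : ys n ∈ cycSubgroup := mem_cycSubgroup_of_strictMono (strictMono_ys n)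

theorem strictMono_x₀ : StrictMono x₀ := by
  intro a b hab
  have h2 : ∀ u, (∃ v, u = P (P v)) ∨ (∃ v, u = Q (P (P v))) ∨ ∃ v, u = Q (Q v) := by
    intro u
    rcases PP_or_Q u with ⟨u, rfl⟩ | ⟨u, rfl⟩
    · exact .inl ⟨u, rfl⟩
    · rcases PP_or_Q u with ⟨u, rfl⟩ | ⟨u, rfl⟩
      exacts [.inr (.inl ⟨u, rfl⟩), .inr (.inr ⟨u, rfl⟩)]
  rcases h2 a with ⟨a, rfl⟩ | ⟨a, rfl⟩ | ⟨a, rfl⟩ <;>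
    rcases h2 b with ⟨b, rfl⟩ | ⟨b, rfl⟩ | ⟨b, rfl⟩ <;>
    revert hab <;> simp [P_lt_P, Q_lt_Q, PP_lt_Q, not_Q_lt_PP]

theorem strictMono_xs (n : ℕ) : StrictMono (xs n) := by
  induction n with
  | zero => exact strictMono_x₀
  | succ n ih => exact strictMono_lift ih

theorem xs_mem (n : ℕ) : xs n ∈ cycSubgroup := mem_cycSubgroup_of_strictMono (strictMono_xs n)

theorem c₀_mem : c₀ ∈ cycSubgroup := by
  intro a b c
  rcases PP_or_Q a with ⟨a, rfl⟩ | ⟨a, rfl⟩ <;> rcases PP_or_Q b with ⟨b, rfl⟩ | ⟨b, rfl⟩ <;>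
    rcases PP_or_Q c with ⟨c, rfl⟩ | ⟨c, rfl⟩ <;>
    simp [Cyc, P_lt_P, Q_lt_Q, PP_lt_Q, not_Q_lt_PP]

theorem cs_mem (n : ℕ) : cs n ∈ cycSubgroup := by
  induction n with
  | zero => exact c₀_mem
  | succ n ih => exact mul_mem (inv_mem (xs_mem n)) ih

end TauCirc

namespace ThatTau

/-- The generators `c_n`, indexed by natural numbers; the value at `0` is irrelevant. -/
def tcn (n : ℕ) : ThatTau := if h : 0 < n then tcg ⟨n, h⟩ else 1

theorem tcn_coe (n : ℕ+) : tcn n = tcg n := dif_pos n.pos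

theorem tcn_coe_succ (n : ℕ+) : tcn ((n : ℕ) + 1) = tcg (n + 1) := tcn_coe (n + 1)

open TGen in
theorem mk_eq_of_mem {i j : ℕ} (hij : i < j) {u v : FreeGroup TGen}
    (h : u * v⁻¹ ∈ ({X j * X i * (X i * X (j + 1))⁻¹,
      X j * Y i * (Y i * X (j + 1))⁻¹,
      Y j * X i * (X i * Y (j + 1))⁻¹,
      Y j * Y i * (Y i * Y (j + 1))⁻¹} : Set (FreeGroup TGen))) :
    PresentedGroup.mk TRels u = PresentedGroup.mk TRels v :=
  PresentedGroup.mk_eq_mk_of_mul_inv_mem <|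
    .inl <| .inl <| .inl <| by simp only [Set.mem_iUnion]; exact ⟨i, j, hij, h⟩

open TGen in
theorem mk_eq_of_mem_c {k : ℕ} {n : ℕ+} (hk : 1 ≤ k) (hn : k < n) {u v : FreeGroup TGen}
    (h : u * v⁻¹ ∈ ({X k * C (n + 1) * (C n * X (k + 1))⁻¹,
      Y k * C (n + 1) * (C n * Y (k + 1))⁻¹} : Set (FreeGroup TGen))) :
    PresentedGroup.mk TRels u = PresentedGroup.mk TRels v :=
  PresentedGroup.mk_eq_mk_of_mul_inv_mem <|
    .inl <| .inr <| by simp only [Set.mem_iUnion]; exact ⟨k, n, hk, hn, h⟩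

open TGen in
theorem mk_eq_one_of_mem (n : ℕ+) {u : FreeGroup TGen}
    (h : u ∈ ({C n * X 0 * (C (n + 1) ^ 2)⁻¹,
      C n * (X (n : ℕ) * C (n + 1))⁻¹,
      C n ^ ((n : ℕ) + 2),
      C n * Y 0 * ((Y ((n : ℕ) + 1))⁻¹ * C (n + 1) ^ 2)⁻¹} : Set (FreeGroup TGen))) :
    PresentedGroup.mk TRels u = 1 :=
  PresentedGroup.one_of_mem <| .inr <| by simp only [Set.mem_iUnion]; exact ⟨n, h⟩

theorem tauRel : TauRel txg tyg tcn where
  xx h := mk_eq_of_mem h (by simp [TGen.X, TGen.Y])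
  xy h := mk_eq_of_mem h (by simp [TGen.X, TGen.Y])
  yx h := mk_eq_of_mem h (by simp [TGen.X, TGen.Y])
  yy h := mk_eq_of_mem h (by simp [TGen.X, TGen.Y])
  y_sq n := by
    have : PresentedGroup.mk TGen.TRels (TGen.Y n ^ 2) =
        PresentedGroup.mk TGen.TRels (TGen.X n * TGen.X (n + 1)) :=
      PresentedGroup.mk_eq_mk_of_mul_inv_mem <|
        .inl <| .inl <| .inr <| by simp only [Set.mem_iUnion]; exact ⟨n, rfl⟩
    rwa [pow_two] at this
  x_c {k n} hk hn := by
    lift n to ℕ+ using by omega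
    rw [tcn_coe, tcn_coe_succ]
    exact mk_eq_of_mem_c hk hn (by simp [TGen.X, TGen.Y, TGen.C])
  y_c {k n} hk hn := by
    lift n to ℕ+ using by omega
    rw [tcn_coe, tcn_coe_succ]
    exact mk_eq_of_mem_c hk hn (by simp [TGen.X, TGen.Y, TGen.C])
  c_x0 {n} hn := by
    lift n to ℕ+ using by omega
    rw [tcn_coe, tcn_coe_succ, ← mul_inv_eq_one, ← pow_two]
    exact mk_eq_one_of_mem n (by simp [TGen.X, TGen.Y, TGen.C])
  c_eq {n} hn := by
    lift n to ℕ+ using by omega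
    rw [tcn_coe, tcn_coe_succ, ← mul_inv_eq_one]
    exact mk_eq_one_of_mem n (by simp [TGen.X, TGen.Y, TGen.C])
  c_pow {n} hn := by
    lift n to ℕ+ using by omega
    rw [tcn_coe]
    exact mk_eq_one_of_mem n (by simp [TGen.X, TGen.Y, TGen.C])
  c_y0 {n} hn := by
    lift n to ℕ+ using by omega
    rw [tcn_coe, tcn_coe_succ, mul_assoc, ← eq_inv_mul_iff_mul_eq, ← mul_inv_eq_one, ← pow_two]
    exact mk_eq_one_of_mem n (by simp [TGen.X, TGen.Y, TGen.C])

theorem eq_top_of_mem {H : Subgroup ThatTau} (hx : ∀ n, txg n ∈ H) (hy : ∀ n, tyg n ∈ H)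
    (hc : ∀ n, tcg n ∈ H) : H = ⊤ := by
  rw [← top_le_iff, ← PresentedGroup.closure_range_of, Subgroup.closure_le]
  rintro _ ⟨n | n | n, rfl⟩
  exacts [hx n, hy n, hc n]

theorem fractions_eq_top : tauRel.fractions = ⊤ :=
  eq_top_of_mem (tauRel.st_mem_fractions true) (tauRel.st_mem_fractions false) fun n =>
    tcn_coe n ▸ tauRel.c_mem_fractions n.pos

/-- The images of the generators in the group of permutations of the circle. -/
def genPerm : TGen → Equiv.Perm TauCirc
  | .x n => TauCirc.xs n
  | .y n => TauCirc.ys n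
  | .c n => TauCirc.cs n

theorem lift_genPerm {r : FreeGroup TGen} (hr : r ∈ TGen.TRels) :
    FreeGroup.lift genPerm r = 1 := by
  have hX : ∀ n, FreeGroup.lift genPerm (TGen.X n) = TauCirc.xs n := fun n =>
    FreeGroup.lift_apply_of
  have hY : ∀ n, FreeGroup.lift genPerm (TGen.Y n) = TauCirc.ys n := fun n =>
    FreeGroup.lift_apply_of
  have hC : ∀ n, FreeGroup.lift genPerm (TGen.C n) = TauCirc.cs n := fun n =>
    FreeGroup.lift_apply_of
  have h := TauCirc.tauRel
  simp only [TGen.TRels, Set.mem_union, Set.mem_iUnion, Set.mem_insert_iff,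
    Set.mem_singleton_iff] at hr
  rcases hr with ((⟨i, j, hij, rfl | rfl | rfl | rfl⟩ | ⟨n, rfl⟩) | ⟨k, n, hk, hn, rfl | rfl⟩) |
    ⟨n, rfl | rfl | rfl | rfl⟩ <;>
    simp only [map_mul, map_inv, map_pow, hX, hY, hC, PNat.add_coe, PNat.one_coe]
  · rw [h.xx hij, mul_inv_cancel]
  · rw [h.xy hij, mul_inv_cancel]
  · rw [h.yx hij, mul_inv_cancel]
  · rw [h.yy hij, mul_inv_cancel]
  · rw [pow_two, h.y_sq, mul_inv_cancel]
  · rw [h.x_c hk hn, mul_inv_cancel]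
  · rw [h.y_c hk hn, mul_inv_cancel]
  · rw [h.c_x0 n.pos, pow_two, mul_inv_cancel]
  · rw [← h.c_eq n.pos, mul_inv_cancel]
  · exact h.c_pow n.pos
  · rw [pow_two, ← h.c_y0 n.pos, mul_inv_eq_one, mul_assoc, inv_mul_cancel_left]

/-- The action on the circle. -/
def toPerm : ThatTau →* Equiv.Perm TauCirc := PresentedGroup.toGroup fun _ => lift_genPerm

theorem toPerm_x (n : ℕ) : toPerm (txg n) = TauCirc.xs n := PresentedGroup.toGroup.of _

theorem toPerm_y (n : ℕ) : toPerm (tyg n) = TauCirc.ys n := PresentedGroup.toGroup.of _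

theorem toPerm_c (n : ℕ+) : toPerm (tcg n) = TauCirc.cs n := PresentedGroup.toGroup.of _

theorem toPerm_mem (g : ThatTau) : toPerm g ∈ TauCirc.cycSubgroup := by
  have : TauCirc.cycSubgroup.comap toPerm = ⊤ := eq_top_of_mem
    (fun n => by rw [Subgroup.mem_comap, toPerm_x]; exact TauCirc.xs_mem n)
    (fun n => by rw [Subgroup.mem_comap, toPerm_y]; exact TauCirc.ys_mem n)
    (fun n => by rw [Subgroup.mem_comap, toPerm_c]; exact TauCirc.cs_mem n)
  exact Subgroup.mem_comap.1 (this ▸ Subgroup.mem_top g)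

theorem eq_one_of_toPerm {g : ThatTau}
    (hg : ∀ t, toPerm g (toPerm t TauCirc.base) = toPerm t TauCirc.base) : g = 1 := by
  let _ : MulAction ThatTau TauCirc := MulAction.compHom TauCirc toPerm
  have hs : ∀ z n, toPerm (tauSt txg tyg z n) = tauSt TauCirc.xs TauCirc.ys z n := by
    rintro (_ | _) n
    exacts [toPerm_y n, toPerm_x n]
  have hc : ∀ {n : ℕ}, 1 ≤ n → toPerm (tcn n) = TauCirc.cs n := by
    intro n hn
    lift n to ℕ+ using by omega
    rw [tcn_coe, toPerm_c]
  have ha : TauAct txg tyg tcn TauCirc.o :=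
    { inj := TauCirc.o_injective
      st_le := fun z i k h => by
        change toPerm _ _ = _
        rw [hs, TauCirc.st_o_le z h]
      st_lt := fun z i k h => by
        change toPerm _ _ = _
        rw [hs, TauCirc.st_o_lt z h]
      c_succ := fun h1 h => by
        change toPerm _ _ = _
        rw [hc h1, TauCirc.cs_o_succ h]
      c_zero := fun h1 => by
        change toPerm _ _ = _
        rw [hc h1, TauCirc.cs_o_zero] }
  exact ha.eq_one tauRel (fractions_eq_top ▸ Subgroup.mem_top g) hg

theorem toPerm_injective : Function.Injective toPerm :=
  (injective_iff_map_eq_one _).2 fun g hg => eq_one_of_toPerm fun t => by rw [hg]; rfl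

end ThatTau

/-- If two consecutive generators `x 2` and `x 3` agree, then all of them are trivial. -/
theorem eq_one_of_x_two_eq_x_three {Q : Type*} [Group Q] {x c : ℕ → Q}
    (xx : ∀ {i j}, i < j → x j * x i = x i * x (j + 1))
    (x_c : ∀ {k n}, 1 ≤ k → k < n → x k * c (n + 1) = c n * x (k + 1))
    (c_x0 : ∀ {n}, 1 ≤ n → c n * x 0 = c (n + 1) * c (n + 1))
    (c_eq : ∀ {n}, 1 ≤ n → c n = x n * c (n + 1))
    (c_pow : ∀ {n}, 1 ≤ n → c n ^ (n + 2) = 1) (h : x 2 = x 3) :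
    (∀ n, x n = 1) ∧ ∀ n, 1 ≤ n → c n = 1 := by
  have h3 : x 3 = 1 := by
    have := x_c (k := 2) (n := 3) (by omega) (by omega)
    rwa [h, ← c_eq (by omega), left_eq_mul] at this
  have h2 : x 2 = 1 := h.trans h3
  have hc23 : c 2 = c 3 := by simpa [h2] using c_eq (n := 2) (by omega)
  have hc3 : c 3 = 1 := by
    have h4 := c_pow (n := 2) (by omega)
    have h5 := c_pow (n := 3) (by omega)
    rw [hc23] at h4
    rwa [pow_succ, h4, one_mul] at h5
  have h0 : x 0 = 1 := by simpa [hc23, hc3] using c_x0 (n := 2) (by omega)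
  have h1 : ∀ n, x (n + 1) = 1 := by
    intro n
    induction n with
    | zero => simpa [h0, h2] using xx Nat.zero_lt_one
    | succ n ih => simpa [h0, ih] using (xx n.succ_pos).symm
  have hx : ∀ n, x n = 1 := by
    rintro (_ | n)
    exacts [h0, h1 n]
  refine ⟨hx, fun n hn => ?_⟩
  have hc1 : c 1 = 1 := by simpa [hx, hc23, hc3] using c_eq (n := 1) le_rfl
  induction n, hn using Nat.le_induction with
  | base => exact hc1
  | succ n hn ih => simpa [hx, ih] using (c_eq hn).symm

namespace TauCirc

/-- A permutation preserving the cyclic order and moving the base point moves a whole arc at the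
base point off itself. -/
theorem le_apply_of_lt {f : Equiv.Perm TauCirc} (hf : f ∈ cycSubgroup) {u : TauCirc}
    (hu : u < f⁻¹ base) (hb : f base ≠ base) : f base ≤ f u := by
  rcases (base_le u).eq_or_lt with rfl | h0
  · exact le_rfl
  have hb' : base < f base := lt_of_le_of_ne (base_le _) hb.symm
  have h := (hf base u (f⁻¹ base)).2 (.inl ⟨h0, hu⟩)
  rw [show f (f⁻¹ base) = base from f.apply_symm_apply base] at h
  rcases h with ⟨-, h⟩ | ⟨h, -⟩ | ⟨-, h⟩
  · exact absurd h (base_le _).not_gt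
  · exact absurd h (base_le _).not_gt
  · exact h.le

/-- If `α` and `β` move only points of an arc at the base point which `f` moves off itself, then
`β` commutes with the conjugate of `α⁻¹` by `f`. -/
theorem commute_conj {f α β : Equiv.Perm TauCirc} (hf : f ∈ cycSubgroup) {ε : TauCirc}
    (h1 : ε ≤ f base) (h2 : ε ≤ f⁻¹ base) (hb : f base ≠ base)
    (hα : ∀ u, ε ≤ u → α u = u) (hβ : ∀ u, ε ≤ u → β u = u) :
    Commute (f * α⁻¹ * f⁻¹) β := by
  refine Equiv.Perm.Disjoint.commute fun u => ?_
  rcases le_or_gt ε u with hu | hu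
  · exact .inr (hβ u hu)
  · left
    have h3 : ε ≤ f⁻¹ u := by
      by_contra! h
      have := le_apply_of_lt hf (h.trans_le h2) hb
      rw [show f (f⁻¹ u) = u from f.apply_symm_apply u] at this
      exact (hu.trans_le (h1.trans this)).false
    have h4 : α⁻¹ (f⁻¹ u) = f⁻¹ u := α.symm_apply_eq.2 (hα _ h3).symm
    rw [Equiv.Perm.mul_apply, Equiv.Perm.mul_apply, h4]
    exact f.apply_symm_apply u

theorem xs_zero_pow_PP (m : ℕ) (u : TauCirc) : (xs 0 ^ m) (P (P u)) = P^[2 * m] (P (P u)) := by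
  induction m generalizing u with
  | zero => rfl
  | succ m ih =>
    rw [pow_succ, Equiv.Perm.mul_apply, show xs 0 = x₀ from rfl, x₀_PP, ← show xs 0 = x₀ from rfl,
      ih, mul_add, Function.iterate_add_apply]
    rfl

theorem coe_iterate_P (k : ℕ) (u : TauCirc) : (P^[k] u : ℝ) = tau ^ k * u := by
  induction k with
  | zero => simp
  | succ k ih =>
    rw [Function.iterate_succ_apply', pow_succ', mul_assoc, ← ih]
    rfl

theorem xs_add_two_apply {n : ℕ} {u : TauCirc} (h : ∀ v, u ≠ Q (Q v)) : xs (n + 2) u = u := by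
  rcases PP_or_Q u with ⟨u, rfl⟩ | ⟨u, rfl⟩
  · rw [xs, lift_PP]
  rcases PP_or_Q u with ⟨u, rfl⟩ | ⟨u, rfl⟩
  · rw [xs, xs, lift_Q, lift_PP]
  · exact absurd rfl (h u)

/-- Conjugation can shrink the supports of the `x n`, `2 ≤ n`, into a given arc. -/
theorem exists_conj_apply_eq {ε : TauCirc} (hε : base < ε) :
    ∃ m : ℕ, ∀ n u, ε ≤ u →
      ((xs 0 ^ m * cs 1 ^ 2) * xs (n + 2) * (xs 0 ^ m * cs 1 ^ 2)⁻¹) u = u := by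
  obtain ⟨m, hm⟩ := exists_pow_lt_of_lt_one (show (0 : ℝ) < ε from hε) tau_lt_one
  refine ⟨m, fun n u hu => ?_⟩
  set D := xs 0 ^ m * cs 1 ^ 2 with hD
  have h1 : D (D⁻¹ u) = u := D.apply_symm_apply u
  rw [Equiv.Perm.mul_apply, Equiv.Perm.mul_apply, xs_add_two_apply, h1]
  intro v hv
  rw [hv, hD, Equiv.Perm.mul_apply, pow_two, Equiv.Perm.mul_apply, cs_one_QQ, cs_one_QPP,
    xs_zero_pow_PP] at h1
  have h2 : (u : ℝ) < tau ^ m := by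
    rw [← h1, coe_iterate_P]
    calc tau ^ (2 * m) * (P (P v) : ℝ) ≤ tau ^ m * (P (P v) : ℝ) :=
          mul_le_mul_of_nonneg_right
            (pow_le_pow_of_le_one tau_pos.le tau_lt_one.le (by omega)) (P (P v)).2.1
      _ < tau ^ m := mul_lt_of_lt_one_right (pow_pos tau_pos m) (P (P v)).2.2
  exact absurd ((show (ε : ℝ) ≤ u from hu).trans_lt h2) hm.not_gt

end TauCirc

namespace ThatTau

theorem x_two_mul_inv_mem_of_commutator {N : Subgroup ThatTau}
    (hN : ∀ t, t ∈ Subgroup.closure (Set.range txg) → ∀ g ∈ N, t * g * t⁻¹ ∈ N)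
    (h : txg 2 * txg 3 * (txg 2)⁻¹ * (txg 3)⁻¹ ∈ N) : txg 2 * (txg 3)⁻¹ ∈ N := by
  have hx : ∀ n, txg n ∈ Subgroup.closure (Set.range txg) := fun n =>
    Subgroup.subset_closure ⟨n, rfl⟩
  have h1 := hN _ (mul_mem (hx 0) (inv_mem (hx 2))) _ h
  have h2 : txg 4 = (txg 2)⁻¹ * txg 3 * txg 2 := by
    rw [mul_assoc, tauRel.xx (by omega : 2 < 3)]; group
  have h3 : txg 2 = txg 0 * txg 3 * (txg 0)⁻¹ := by
    rw [← tauRel.xx (by omega : 0 < 2)]; group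
  have h4 : txg 3 = txg 0 * txg 4 * (txg 0)⁻¹ := by
    rw [← tauRel.xx (by omega : 0 < 3)]; group
  have h5 : txg 2 * (txg 3)⁻¹ = txg 0 * (txg 3 * (txg 4)⁻¹) * (txg 0)⁻¹ := by
    rw [h3]
    nth_rw 2 [h4]
    group
  rw [h5, h2]
  convert h1 using 1
  group

theorem x_two_mul_inv_mem {K N : Subgroup ThatTau} (hxK : ∀ n, txg n ∈ K)
    (hcK : ∀ n, tcg n ∈ K) (hK : ∀ t, t ∈ K ∨ t * tyg 0 ∈ K)
    (hN : ∀ t ∈ K, ∀ g ∈ N, t * g * t⁻¹ ∈ N) {g : ThatTau} (hg : g ∈ N) (hg1 : g ≠ 1) :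
    txg 2 * (txg 3)⁻¹ ∈ N := by
  obtain ⟨t, htK, ht⟩ : ∃ t ∈ K, toPerm g (toPerm t TauCirc.base) ≠ toPerm t TauCirc.base := by
    by_contra! h
    refine hg1 (eq_one_of_toPerm fun t => ?_)
    rcases hK t with ht | ht
    · exact h t ht
    · have := h _ ht
      rw [map_mul, Equiv.Perm.mul_apply, toPerm_y] at this
      rwa [show TauCirc.ys 0 TauCirc.base = TauCirc.base from
        TauCirc.st_o_le false (le_refl 0)] at this
  set f := t⁻¹ * g * t with hf
  have hfN : f ∈ N := by simpa [hf] using hN _ (inv_mem htK) g hg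
  have hb : toPerm f TauCirc.base ≠ TauCirc.base := by
    rw [hf, map_mul, map_mul, map_inv]
    exact fun h => ht ((toPerm t).symm_apply_eq.1 h)
  have hb' : (toPerm f)⁻¹ TauCirc.base ≠ TauCirc.base := fun h =>
    hb ((toPerm f).symm_apply_eq.1 h).symm
  have hε : TauCirc.base < min (toPerm f TauCirc.base) ((toPerm f)⁻¹ TauCirc.base) :=
    lt_min (lt_of_le_of_ne (TauCirc.base_le _) hb.symm)
      (lt_of_le_of_ne (TauCirc.base_le _) hb'.symm)
  obtain ⟨m, hm⟩ := TauCirc.exists_conj_apply_eq hε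
  set D := txg 0 ^ m * tcg 1 ^ 2 with hD
  have hDK : D ∈ K := mul_mem (pow_mem (hxK 0) m) (pow_mem (hcK 1) 2)
  have hDp : ∀ n, toPerm (D * txg n * D⁻¹) =
      (TauCirc.xs 0 ^ m * TauCirc.cs 1 ^ 2) * TauCirc.xs n *
        (TauCirc.xs 0 ^ m * TauCirc.cs 1 ^ 2)⁻¹ := by
    intro n
    simp only [hD, map_mul, map_inv, map_pow, toPerm_x, toPerm_c, PNat.one_coe]
  set α := D * txg 2 * D⁻¹ with hα
  set β := D * txg 3 * D⁻¹ with hβ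
  have hcomm : Commute (f * α⁻¹ * f⁻¹) β := by
    apply toPerm_injective
    simp only [map_mul, map_inv]
    exact TauCirc.commute_conj (toPerm_mem f) (min_le_left _ _) (min_le_right _ _) hb
      (by rw [hα, hDp]; exact hm 0) (by rw [hβ, hDp]; exact hm 1)
  have hαK : α ∈ K := mul_mem (mul_mem hDK (hxK 2)) (inv_mem hDK)
  have hβK : β ∈ K := mul_mem (mul_mem hDK (hxK 3)) (inv_mem hDK)
  have h1 : α * (f * α⁻¹ * f⁻¹) ∈ N := by
    simpa only [mul_assoc] using mul_mem (hN α hαK f hfN) (inv_mem hfN)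
  have h2 : α * β * α⁻¹ * β⁻¹ ∈ N := by
    have h3 := mul_mem h1 (hN β hβK _ (inv_mem h1))
    have h4 : ∀ a b d : ThatTau, Commute d b →
        a * b * a⁻¹ * b⁻¹ = a * d * (b * (a * d)⁻¹ * b⁻¹) := by
      intro a b d h
      rw [mul_inv_rev, ← mul_assoc b, h.symm.inv_right.eq]
      group
    rwa [h4 α β _ hcomm]
  refine x_two_mul_inv_mem_of_commutator (fun t ht => hN t ?_) ?_
  · exact (Subgroup.closure_le K).2 (by rintro _ ⟨n, rfl⟩; exact hxK n) ht
  · convert hN _ (inv_mem hDK) _ h2 using 1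
    rw [hα, hβ]
    group

theorem mem_of_normal {K : Subgroup ThatTau} (hxK : ∀ n, txg n ∈ K)
    (hcK : ∀ n, tcg n ∈ K) (hK : ∀ t, t ∈ K ∨ t * tyg 0 ∈ K)
    {N : Subgroup K} [N.Normal] (hN : N ≠ ⊥) :
    (∀ n, (⟨txg n, hxK n⟩ : K) ∈ N) ∧ ∀ n, (⟨tcg n, hcK n⟩ : K) ∈ N := by
  have hcK' : ∀ n, tcn n ∈ K := by
    intro n
    rw [tcn]
    split_ifs
    exacts [hcK _, one_mem K]
  obtain ⟨g, hg, hg1⟩ := N.bot_or_exists_ne_one.resolve_left hN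
  have h1 : txg 2 * (txg 3)⁻¹ ∈ N.map K.subtype := by
    refine x_two_mul_inv_mem hxK hcK hK ?_ (Subgroup.mem_map_of_mem K.subtype hg)
      fun h => hg1 (Subtype.ext h)
    rintro t ht _ ⟨n, hn, rfl⟩
    exact ⟨⟨t, ht⟩ * n * ⟨t, ht⟩⁻¹, Subgroup.Normal.conj_mem ‹_› n hn _, rfl⟩
  obtain ⟨n, hn, hn'⟩ := h1
  obtain ⟨hx, hc⟩ := eq_one_of_x_two_eq_x_three
    (x := fun n => QuotientGroup.mk' N ⟨txg n, hxK n⟩)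
    (c := fun n => QuotientGroup.mk' N ⟨tcn n, hcK' n⟩)
    (fun h => by
      simp only [← map_mul]
      exact congrArg _ (Subtype.ext (tauRel.xx h)))
    (fun h1 h2 => by
      simp only [← map_mul]
      exact congrArg _ (Subtype.ext (tauRel.x_c h1 h2)))
    (fun h => by
      simp only [← map_mul]
      exact congrArg _ (Subtype.ext (tauRel.c_x0 h)))
    (fun h => by
      simp only [← map_mul]
      exact congrArg _ (Subtype.ext (tauRel.c_eq h)))
    (fun {n} h => by
      simp only [← map_pow]
      rw [← map_one (QuotientGroup.mk' N)]
      exact congrArg _ (Subtype.ext (tauRel.c_pow h)))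
    (by
      rw [← mul_inv_eq_one, ← map_inv, ← map_mul, ← MonoidHom.mem_ker, QuotientGroup.ker_mk']
      rwa [show (⟨txg 2, hxK 2⟩ * ⟨txg 3, hxK 3⟩⁻¹ : K) = n from Subtype.ext hn'.symm])
  refine ⟨fun n => (QuotientGroup.eq_one_iff _).1 (hx n), fun n => ?_⟩
  have := (QuotientGroup.eq_one_iff _).1 (hc n n.pos)
  simpa only [tcn_coe] using this

/-- A normal subgroup containing all `x n` and `c n` has index at most two. -/
theorem mem_or_inv_mul_mem {R : Subgroup ThatTau} [R.Normal] (hx : ∀ n, txg n ∈ R)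
    (hc : ∀ n, tcg n ∈ R) (g : ThatTau) : g ∈ R ∨ g⁻¹ * tyg 0 ∈ R := by
  set π := QuotientGroup.mk' R
  have hmem : ∀ {g}, π g = 1 ↔ g ∈ R := QuotientGroup.eq_one_iff _
  have hπx : ∀ n, π (txg n) = 1 := fun n => hmem.2 (hx n)
  have hπc : ∀ n, 1 ≤ n → π (tcn n) = 1 := by
    intro n hn
    lift n to ℕ+ using by omega
    rw [tcn_coe]
    exact hmem.2 (hc n)
  have hsq : ∀ n, π (tyg n) * π (tyg n) = 1 := by
    intro n
    rw [← map_mul, tauRel.y_sq, map_mul, hπx, hπx, one_mul]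
  have h2 : π (tyg 2) = π (tyg 0) := by
    have h := congrArg π (tauRel.c_y0 (le_refl 1))
    simp only [map_mul, hπc 1 le_rfl, hπc 2 one_le_two, mul_one] at h
    rw [eq_inv_of_mul_eq_one_left h, inv_eq_of_mul_eq_one_left (hsq 0)]
  have hstep : ∀ n, 1 ≤ n → π (tyg (n + 1)) = π (tyg n) := by
    intro n hn
    simpa [hπx] using congrArg π (tauRel.yx (i := 0) hn).symm
  have hy : ∀ n, 1 ≤ n → π (tyg n) = π (tyg 0) := by
    intro n hn
    induction n, hn using Nat.le_induction with
    | base => rw [← hstep 1 le_rfl, h2]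
    | succ n hn ih => rw [hstep n hn, ih]
  have htop : (Subgroup.zpowers (π (tyg 0))).comap π = ⊤ := by
    refine eq_top_of_mem (fun n => ?_) (fun n => ?_) fun n => ?_
    · rw [Subgroup.mem_comap, hπx]
      exact one_mem _
    · rcases Nat.eq_zero_or_pos n with rfl | hn
      · exact Subgroup.mem_zpowers _
      · rw [Subgroup.mem_comap, hy n hn]
        exact Subgroup.mem_zpowers _
    · rw [Subgroup.mem_comap, hmem.2 (hc n)]
      exact one_mem _
  obtain ⟨k, hk⟩ : π g ∈ Subgroup.zpowers (π (tyg 0)) := by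
    rw [← Subgroup.mem_comap, htop]
    exact Subgroup.mem_top g
  replace hk : π (tyg 0) ^ k = π g := hk
  rcases Int.even_or_odd' k with ⟨l, rfl | rfl⟩
  · left
    rw [← hmem, ← hk, zpow_mul, zpow_ofNat, pow_two, hsq, one_zpow]
  · right
    rw [← hmem, map_mul, map_inv, ← hk, zpow_add, zpow_mul, zpow_ofNat, pow_two, hsq, one_zpow,
      one_mul, zpow_one, inv_mul_cancel]

theorem eq_top_of_normal {K : Subgroup ThatTau} [K.Normal] (hxK : ∀ n, txg n ∈ K)
    (hcK : ∀ n, tcg n ∈ K) (hyK : tyg 0 ∉ K) (hK : ∀ t, t ∈ K ∨ t * tyg 0 ∈ K)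
    {N : Subgroup K} (hNn : N.Normal) (hN : N ≠ ⊥) : N = ⊤ := by
  set e : K ≃* K := MulAut.conjNormal (tyg 0)⁻¹ with he
  have hN' : N.comap e.toMonoidHom ≠ ⊥ := by
    obtain ⟨g, hg, hg1⟩ := N.bot_or_exists_ne_one.resolve_left hN
    refine fun h => hg1 (e.symm.map_eq_one_iff.1 ?_)
    rw [← Subgroup.mem_bot, ← h]
    change e (e.symm g) ∈ N
    rwa [e.apply_symm_apply]
  obtain ⟨hx, hc⟩ := mem_of_normal hxK hcK hK hN
  obtain ⟨hx', hc'⟩ := mem_of_normal hxK hcK hK hN'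
  have hconj : ∀ g : K, g ∈ N → g ∈ N.comap e.toMonoidHom → ∀ t : ThatTau,
      t * g * t⁻¹ ∈ N.map K.subtype := by
    intro g hg hg' t
    rcases hK t with ht | ht
    · exact ⟨⟨t, ht⟩ * g * ⟨t, ht⟩⁻¹, hNn.conj_mem g hg _, rfl⟩
    · refine ⟨⟨_, ht⟩ * e g * ⟨_, ht⟩⁻¹, hNn.conj_mem _ hg' _, ?_⟩
      have heg : (e g : ThatTau) = (tyg 0)⁻¹ * g * tyg 0 := by
        rw [he, MulAut.conjNormal_apply, inv_inv]
      simp only [map_mul, map_inv, Subgroup.subtype_apply, heg]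
      group
  set R := Subgroup.normalClosure (Set.range txg ∪ Set.range tcg) with hR
  have hRN : R ≤ N.map K.subtype := by
    rw [hR, Subgroup.normalClosure, Subgroup.closure_le]
    intro g hg
    obtain ⟨s, hs, hsg⟩ := Group.mem_conjugatesOfSet_iff.1 hg
    obtain ⟨t, rfl⟩ := isConj_iff.1 hsg
    rcases hs with ⟨n, rfl⟩ | ⟨n, rfl⟩
    · exact hconj _ (hx n) (hx' n) t
    · exact hconj _ (hc n) (hc' n) t
  have hRK : R ≤ K := hRN.trans (Subgroup.map_subtype_le N)
  refine eq_top_iff.2 fun g _ => ?_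
  rcases mem_or_inv_mul_mem (R := R) (fun n => Subgroup.subset_normalClosure (.inl ⟨n, rfl⟩))
    (fun n => Subgroup.subset_normalClosure (.inr ⟨n, rfl⟩)) g with h | h
  · obtain ⟨n, hn, hng⟩ := hRN h
    rwa [← Subtype.ext hng]
  · exact absurd ((K.mul_mem_cancel_left (inv_mem g.2)).1 (hRK h)) hyK

theorem txg_zero_ne_one : txg 0 ≠ 1 := by
  intro h
  have h1 : TauCirc.xs 0 (TauCirc.o 2) = TauCirc.o 1 := TauCirc.st_o_lt true Nat.zero_lt_one
  rw [← toPerm_x, h, map_one] at h1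
  exact absurd (TauCirc.o_injective h1) (by decide)

end ThatTau

/-- The group `T_xz`, the kernel of the parity-of-`y` homomorphism, is simple. -/
theorem Txz_simple (φ : ThatTau →* Multiplicative (ZMod 2))
    (hx : ∀ n : ℕ, φ (txg n) = Multiplicative.ofAdd (0 : ZMod 2))
    (hc : ∀ n : ℕ+, φ (tcg n) = Multiplicative.ofAdd (0 : ZMod 2))
    (hy : ∀ n : ℕ, φ (tyg n) = Multiplicative.ofAdd (1 : ZMod 2)) :
    IsSimpleGroup (MonoidHom.ker φ) := by
  have hxK : ∀ n, txg n ∈ φ.ker := hx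
  have hcK : ∀ n, tcg n ∈ φ.ker := hc
  have hyK : tyg 0 ∉ φ.ker := by
    rw [MonoidHom.mem_ker, hy]
    decide
  have hK : ∀ t, t ∈ φ.ker ∨ t * tyg 0 ∈ φ.ker := by
    intro t
    rw [MonoidHom.mem_ker, MonoidHom.mem_ker, map_mul, hy]
    generalize φ t = a
    revert a
    decide
  have : Nontrivial φ.ker :=
    ⟨⟨⟨txg 0, hxK 0⟩, 1, fun h => ThatTau.txg_zero_ne_one (congrArg Subtype.val h)⟩⟩
  refine ⟨fun N hN => or_iff_not_imp_left.2 fun h => ?_⟩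
  exact ThatTau.eq_top_of_normal hxK hcK hyK hK hN h

end
end

section
/- Every element g of the presented group V̂_τ can be written in the form g = p · σ · q⁻¹, where p = x_0^{a_0} y_0^{ε_0} x_1^{a_1} y_1^{ε_1} ⋯ x_n^{a_n} y_n^{ε_n} with a_i ≥ 0 and ε_i ∈ {0,1}, σ lies in the subgroup of V̂_τ generated by {c_k : k ≥ 1} ∪ {π_k : k ≥ 0}, and q⁻¹ = x_m^{−b_m} x_{m−1}^{−b_{m−1}} ⋯ x_0^{−b_0} with b_j ≥ 0. -/
/-!
STATEMENT 8: Every element `g` of the presented group `V̂_τ` can be written in the form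
`g = p * σ * q⁻¹`, where
`p = x_0^{a_0} y_0^{ε_0} x_1^{a_1} y_1^{ε_1} ⋯ x_n^{a_n} y_n^{ε_n}` with `a_i ≥ 0`,
`ε_i ∈ {0,1}`, `σ` lies in the subgroup generated by `{c_k : k ≥ 1} ∪ {π_k : k ≥ 0}`, and
`q⁻¹ = x_m^{−b_m} x_{m−1}^{−b_{m−1}} ⋯ x_0^{−b_0}` with `b_j ≥ 0`.
-/

noncomputable section

/-- Generators of the presented group `V̂_τ`: `x n`, `y n`, `p n` (the transpositions `π_n`)
for `n ≥ 0` and `c n` for `n ≥ 1` (indexed by positive naturals). -/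
inductive VGen : Type
  | x : ℕ → VGen
  | y : ℕ → VGen
  | p : ℕ → VGen
  | c : ℕ+ → VGen

namespace VGen

/-- The free-group generator `x_n`. -/
def X (n : ℕ) : FreeGroup VGen := FreeGroup.of (VGen.x n)
/-- The free-group generator `y_n`. -/
def Y (n : ℕ) : FreeGroup VGen := FreeGroup.of (VGen.y n)
/-- The free-group generator `π_n`. -/
def P (n : ℕ) : FreeGroup VGen := FreeGroup.of (VGen.p n)
/-- The free-group generator `c_n`, `n ≥ 1`. -/
def C (n : ℕ+) : FreeGroup VGen := FreeGroup.of (VGen.c n)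

/-- The defining relators of `V̂_τ` (each relation `u = v` is recorded as `u * v⁻¹`). -/
def VRels : Set (FreeGroup VGen) :=
  -- (1.1)–(1.4): a_j b_i = b_i a_{j+1} for i < j, a, b ∈ {x, y}
  (⋃ (i : ℕ) (j : ℕ) (_ : i < j),
    ({X j * X i * (X i * X (j + 1))⁻¹,
      X j * Y i * (Y i * X (j + 1))⁻¹,
      Y j * X i * (X i * Y (j + 1))⁻¹,
      Y j * Y i * (Y i * Y (j + 1))⁻¹} : Set (FreeGroup VGen))) ∪
  -- (1.5): y_n² = x_n x_{n+1}
  (⋃ (n : ℕ), ({Y n ^ 2 * (X n * X (n + 1))⁻¹} : Set (FreeGroup VGen))) ∪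
  -- (2.1) and (3.1): a_k c_{n+1} = c_n a_{k+1} for 1 ≤ k < n, a ∈ {x, y}
  (⋃ (k : ℕ) (n : ℕ+) (_ : 1 ≤ k) (_ : (k : ℕ) < (n : ℕ)),
    ({X k * C (n + 1) * (C n * X (k + 1))⁻¹,
      Y k * C (n + 1) * (C n * Y (k + 1))⁻¹} : Set (FreeGroup VGen))) ∪
  -- (2.2), (2.3), (2.4), (3.2), for n ≥ 1
  (⋃ (n : ℕ+),
    ({C n * X 0 * (C (n + 1) ^ 2)⁻¹,
      C n * (X (n : ℕ) * C (n + 1))⁻¹,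
      C n ^ ((n : ℕ) + 2),
      C n * Y 0 * ((Y ((n : ℕ) + 1))⁻¹ * C (n + 1) ^ 2)⁻¹} : Set (FreeGroup VGen))) ∪
  -- (4.1), (4.7), (6.1): π_i commutes with x_j, π_j, y_j for j ≥ i + 2
  (⋃ (i : ℕ) (j : ℕ) (_ : i + 2 ≤ j),
    ({P i * X j * (X j * P i)⁻¹,
      P i * P j * (P j * P i)⁻¹,
      P i * Y j * (Y j * P i)⁻¹} : Set (FreeGroup VGen))) ∪
  -- (4.2), (4.3), (4.5), (4.6), (6.2), (6.3)
  (⋃ (i : ℕ),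
    ({P i * X (i + 1) * (X i * P (i + 1) * P i)⁻¹,
      P i * X i * (X (i + 1) * P i * P (i + 1))⁻¹,
      P i ^ 2,
      (P (i + 1) * P i) ^ 3,
      P i * Y (i + 1) * (Y i * P (i + 1) * P i)⁻¹,
      P i * Y i * (Y (i + 1) * P i * P (i + 1))⁻¹} : Set (FreeGroup VGen))) ∪
  -- (4.4), (6.4): π_i a_j = a_j π_{i+1} for 0 ≤ j < i, a ∈ {x, y}
  (⋃ (i : ℕ) (j : ℕ) (_ : j < i),
    ({P i * X j * (X j * P (i + 1))⁻¹,
      P i * Y j * (Y j * P (i + 1))⁻¹} : Set (FreeGroup VGen))) ∪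
  -- (5.1): c_n π_k = π_{k−1} c_n for 1 ≤ k ≤ n − 1
  (⋃ (n : ℕ+) (k : ℕ) (_ : 1 ≤ k) (_ : k ≤ (n : ℕ) - 1),
    ({C n * P k * (P (k - 1) * C n)⁻¹} : Set (FreeGroup VGen))) ∪
  -- (5.2), (5.3), (5.4), for n ≥ 1
  (⋃ (n : ℕ+),
    ({C n * P 0 * (((List.range (n : ℕ)).map P).prod * C n ^ 2)⁻¹,
      C n ^ 2 * P 0 * (((List.range (n : ℕ)).reverse.map P).prod * C n)⁻¹,
      C n ^ 3 * P 0 * (P ((n : ℕ) - 1) * C n ^ 3)⁻¹} : Set (FreeGroup VGen)))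

end VGen

/-- The presented group `V̂_τ`. -/
abbrev VhatTau : Type := PresentedGroup VGen.VRels

/-- The generator `x_n` of `V̂_τ`. -/
def vxg (n : ℕ) : VhatTau := PresentedGroup.of (VGen.x n)
/-- The generator `y_n` of `V̂_τ`. -/
def vyg (n : ℕ) : VhatTau := PresentedGroup.of (VGen.y n)
/-- The generator `π_n` of `V̂_τ`. -/
def vpg (n : ℕ) : VhatTau := PresentedGroup.of (VGen.p n)
/-- The generator `c_n` of `V̂_τ`, `n ≥ 1`. -/
def vcg (n : ℕ+) : VhatTau := PresentedGroup.of (VGen.c n)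


namespace VhatTau

open VGen

/-! ### The defining relations, as equations in `V̂_τ` -/

theorem mk_eq_of_mem {u v : FreeGroup VGen} (h : u * v⁻¹ ∈ VRels) :
    PresentedGroup.mk VRels u = PresentedGroup.mk VRels v := by
  have h1 := PresentedGroup.one_of_mem h
  rwa [map_mul, map_inv, mul_inv_eq_one] at h1

/-- The generator `c_{n+1}`, indexed by a natural number. -/
def cSucc (n : ℕ) : VhatTau := vcg n.succPNat

theorem shift_mem {i j : ℕ} (h : i < j) {r : FreeGroup VGen}
    (hr : r ∈ ({X j * X i * (X i * X (j + 1))⁻¹, X j * Y i * (Y i * X (j + 1))⁻¹,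
      Y j * X i * (X i * Y (j + 1))⁻¹, Y j * Y i * (Y i * Y (j + 1))⁻¹} :
        Set (FreeGroup VGen))) : r ∈ VRels := by
  simp only [VRels, Set.mem_union, Set.mem_iUnion]
  iterate 8 left
  exact ⟨i, j, h, hr⟩

theorem vxg_mul_vxg {i j : ℕ} (h : i < j) : vxg j * vxg i = vxg i * vxg (j + 1) := by
  have := mk_eq_of_mem (shift_mem h (r := X j * X i * (X i * X (j + 1))⁻¹) (by simp))
  simp only [map_mul] at this
  exact this

theorem vxg_mul_vyg {i j : ℕ} (h : i < j) : vxg j * vyg i = vyg i * vxg (j + 1) := by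
  have := mk_eq_of_mem (shift_mem h (r := X j * Y i * (Y i * X (j + 1))⁻¹) (by simp))
  simp only [map_mul] at this
  exact this

theorem vyg_mul_vxg {i j : ℕ} (h : i < j) : vyg j * vxg i = vxg i * vyg (j + 1) := by
  have := mk_eq_of_mem (shift_mem h (r := Y j * X i * (X i * Y (j + 1))⁻¹) (by simp))
  simp only [map_mul] at this
  exact this

theorem vyg_mul_vyg {i j : ℕ} (h : i < j) : vyg j * vyg i = vyg i * vyg (j + 1) := by
  have := mk_eq_of_mem (shift_mem h (r := Y j * Y i * (Y i * Y (j + 1))⁻¹) (by simp))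
  simp only [map_mul] at this
  exact this

theorem vyg_mul_self (n : ℕ) : vyg n * vyg n = vxg n * vxg (n + 1) := by
  have hm : Y n ^ 2 * (X n * X (n + 1))⁻¹ ∈ VRels := by
    simp only [VRels, Set.mem_union, Set.mem_iUnion]
    iterate 7 left
    exact Or.inr ⟨n, rfl⟩
  have := mk_eq_of_mem hm
  simp only [map_mul, pow_two] at this
  exact this

theorem c_shift_mem {k n : ℕ} (h1 : 1 ≤ k) (h2 : k ≤ n) {r : FreeGroup VGen}
    (hr : r ∈ ({X k * C (n.succPNat + 1) * (C n.succPNat * X (k + 1))⁻¹,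
      Y k * C (n.succPNat + 1) * (C n.succPNat * Y (k + 1))⁻¹} : Set (FreeGroup VGen))) :
    r ∈ VRels := by
  simp only [VRels, Set.mem_union, Set.mem_iUnion]
  iterate 6 left
  exact Or.inr ⟨k, n.succPNat, h1, by simp; omega, hr⟩

theorem cSucc_mul_vxg_succ {k n : ℕ} (h1 : 1 ≤ k) (h2 : k ≤ n) :
    cSucc n * vxg (k + 1) = vxg k * cSucc (n + 1) := by
  have := mk_eq_of_mem (c_shift_mem h1 h2
    (r := X k * C (n.succPNat + 1) * (C n.succPNat * X (k + 1))⁻¹) (by simp))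
  simp only [map_mul] at this
  exact this.symm

theorem cSucc_mul_vyg_succ {k n : ℕ} (h1 : 1 ≤ k) (h2 : k ≤ n) :
    cSucc n * vyg (k + 1) = vyg k * cSucc (n + 1) := by
  have := mk_eq_of_mem (c_shift_mem h1 h2
    (r := Y k * C (n.succPNat + 1) * (C n.succPNat * Y (k + 1))⁻¹) (by simp))
  simp only [map_mul] at this
  exact this.symm

theorem c_mem (n : ℕ+) {r : FreeGroup VGen}
    (hr : r ∈ ({C n * X 0 * (C (n + 1) ^ 2)⁻¹, C n * (X (n : ℕ) * C (n + 1))⁻¹,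
      C n ^ ((n : ℕ) + 2), C n * Y 0 * ((Y ((n : ℕ) + 1))⁻¹ * C (n + 1) ^ 2)⁻¹} :
        Set (FreeGroup VGen))) : r ∈ VRels := by
  simp only [VRels, Set.mem_union, Set.mem_iUnion]
  iterate 5 left
  exact Or.inr ⟨n, hr⟩

theorem cSucc_mul_vxg_zero (n : ℕ) : cSucc n * vxg 0 = cSucc (n + 1) ^ 2 := by
  have := mk_eq_of_mem (c_mem n.succPNat
    (r := C n.succPNat * X 0 * (C (n.succPNat + 1) ^ 2)⁻¹) (by simp))
  simp only [map_mul, map_pow] at this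
  exact this

theorem cSucc_eq (n : ℕ) : cSucc n = vxg (n + 1) * cSucc (n + 1) := by
  have := mk_eq_of_mem (c_mem n.succPNat
    (r := C n.succPNat * (X (n.succPNat : ℕ) * C (n.succPNat + 1))⁻¹) (by simp))
  simp only [map_mul] at this
  exact this

theorem cSucc_pow (n : ℕ) : cSucc n ^ (n + 3) = 1 := by
  have := PresentedGroup.one_of_mem (c_mem n.succPNat
    (r := C n.succPNat ^ ((n.succPNat : ℕ) + 2)) (by simp))
  simp only [map_pow] at this
  exact this

theorem cSucc_mul_vyg_zero (n : ℕ) :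
    cSucc n * vyg 0 = (vyg (n + 2))⁻¹ * cSucc (n + 1) ^ 2 := by
  have := mk_eq_of_mem (c_mem n.succPNat
    (r := C n.succPNat * Y 0 * ((Y ((n.succPNat : ℕ) + 1))⁻¹ * C (n.succPNat + 1) ^ 2)⁻¹)
    (by simp))
  simp only [map_mul, map_pow, map_inv] at this
  exact this

theorem p_comm_mem {i j : ℕ} (h : i + 2 ≤ j) {r : FreeGroup VGen}
    (hr : r ∈ ({P i * X j * (X j * P i)⁻¹, P i * P j * (P j * P i)⁻¹,
      P i * Y j * (Y j * P i)⁻¹} : Set (FreeGroup VGen))) : r ∈ VRels := by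
  simp only [VRels, Set.mem_union, Set.mem_iUnion]
  iterate 4 left
  exact Or.inr ⟨i, j, h, hr⟩

theorem vpg_mul_vxg_of_add_two_le {i j : ℕ} (h : i + 2 ≤ j) :
    vpg i * vxg j = vxg j * vpg i := by
  have := mk_eq_of_mem (p_comm_mem h (r := P i * X j * (X j * P i)⁻¹) (by simp))
  simp only [map_mul] at this
  exact this

theorem vpg_mul_vyg_of_add_two_le {i j : ℕ} (h : i + 2 ≤ j) :
    vpg i * vyg j = vyg j * vpg i := by
  have := mk_eq_of_mem (p_comm_mem h (r := P i * Y j * (Y j * P i)⁻¹) (by simp))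
  simp only [map_mul] at this
  exact this

theorem p_mem (i : ℕ) {r : FreeGroup VGen}
    (hr : r ∈ ({P i * X (i + 1) * (X i * P (i + 1) * P i)⁻¹,
      P i * X i * (X (i + 1) * P i * P (i + 1))⁻¹, P i ^ 2, (P (i + 1) * P i) ^ 3,
      P i * Y (i + 1) * (Y i * P (i + 1) * P i)⁻¹,
      P i * Y i * (Y (i + 1) * P i * P (i + 1))⁻¹} : Set (FreeGroup VGen))) : r ∈ VRels := by
  simp only [VRels, Set.mem_union, Set.mem_iUnion]
  iterate 3 left
  exact Or.inr ⟨i, hr⟩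

theorem vpg_mul_vxg_succ (i : ℕ) : vpg i * vxg (i + 1) = vxg i * vpg (i + 1) * vpg i := by
  have := mk_eq_of_mem (p_mem i (r := P i * X (i + 1) * (X i * P (i + 1) * P i)⁻¹) (by simp))
  simp only [map_mul] at this
  exact this

theorem vpg_mul_vxg_self (i : ℕ) : vpg i * vxg i = vxg (i + 1) * vpg i * vpg (i + 1) := by
  have := mk_eq_of_mem (p_mem i (r := P i * X i * (X (i + 1) * P i * P (i + 1))⁻¹) (by simp))
  simp only [map_mul] at this
  exact this

theorem vpg_mul_vyg_succ (i : ℕ) : vpg i * vyg (i + 1) = vyg i * vpg (i + 1) * vpg i := by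
  have := mk_eq_of_mem (p_mem i (r := P i * Y (i + 1) * (Y i * P (i + 1) * P i)⁻¹) (by simp))
  simp only [map_mul] at this
  exact this

theorem vpg_mul_vyg_self (i : ℕ) : vpg i * vyg i = vyg (i + 1) * vpg i * vpg (i + 1) := by
  have := mk_eq_of_mem (p_mem i (r := P i * Y i * (Y (i + 1) * P i * P (i + 1))⁻¹) (by simp))
  simp only [map_mul] at this
  exact this

theorem vpg_mul_self (i : ℕ) : vpg i * vpg i = 1 := by
  have := PresentedGroup.one_of_mem (p_mem i (r := P i ^ 2) (by simp))
  simp only [pow_two] at this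
  exact this

theorem p_shift_mem {i j : ℕ} (h : j < i) {r : FreeGroup VGen}
    (hr : r ∈ ({P i * X j * (X j * P (i + 1))⁻¹,
      P i * Y j * (Y j * P (i + 1))⁻¹} : Set (FreeGroup VGen))) : r ∈ VRels := by
  simp only [VRels, Set.mem_union, Set.mem_iUnion]
  iterate 2 left
  exact Or.inr ⟨i, j, h, hr⟩

theorem vpg_mul_vxg_of_lt {i j : ℕ} (h : j < i) : vpg i * vxg j = vxg j * vpg (i + 1) := by
  have := mk_eq_of_mem (p_shift_mem h (r := P i * X j * (X j * P (i + 1))⁻¹) (by simp))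
  simp only [map_mul] at this
  exact this

theorem vpg_mul_vyg_of_lt {i j : ℕ} (h : j < i) : vpg i * vyg j = vyg j * vpg (i + 1) := by
  have := mk_eq_of_mem (p_shift_mem h (r := P i * Y j * (Y j * P (i + 1))⁻¹) (by simp))
  simp only [map_mul] at this
  exact this

theorem cSucc_mul_vpg_zero (n : ℕ) :
    cSucc n * vpg 0 = ((List.range (n + 1)).map vpg).prod * cSucc n ^ 2 := by
  have hm : C n.succPNat * P 0 *
      (((List.range (n.succPNat : ℕ)).map P).prod * C n.succPNat ^ 2)⁻¹ ∈ VRels := by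
    simp only [VRels, Set.mem_union, Set.mem_iUnion]
    exact Or.inr ⟨n.succPNat, by simp⟩
  have := mk_eq_of_mem hm
  simp only [map_mul, map_pow, map_list_prod, List.map_map] at this
  exact this

/-! ### The subgroup generated by the `c_n` and the `π_n` -/

/-- The subgroup generated by all `c_n` and `π_n`. -/
def permSubgroup : Subgroup VhatTau := Subgroup.closure (Set.range vcg ∪ Set.range vpg)

theorem cSucc_mem (n : ℕ) : cSucc n ∈ permSubgroup :=
  Subgroup.subset_closure (Or.inl ⟨_, rfl⟩)

theorem vpg_mem (n : ℕ) : vpg n ∈ permSubgroup :=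
  Subgroup.subset_closure (Or.inr ⟨_, rfl⟩)

theorem vxg_mem (n : ℕ) : vxg n ∈ permSubgroup := by
  cases n with
  | zero =>
    rw [show vxg 0 = (cSucc 0)⁻¹ * cSucc 1 ^ 2 by rw [← cSucc_mul_vxg_zero]; group]
    exact mul_mem (inv_mem (cSucc_mem _)) (pow_mem (cSucc_mem _) _)
  | succ n =>
    rw [show vxg (n + 1) = cSucc n * (cSucc (n + 1))⁻¹ by rw [cSucc_eq n]; group]
    exact mul_mem (cSucc_mem _) (inv_mem (cSucc_mem _))

theorem vyg_inv_eq (i : ℕ) : (vyg i)⁻¹ = vyg i * ((vxg (i + 1))⁻¹ * (vxg i)⁻¹) := by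
  rw [← mul_inv_rev, ← vyg_mul_self]; group

theorem vxg_mul_vyg_self (i : ℕ) :
    vxg i * vyg i = vyg i * (vxg i * vxg (i + 1) * (vxg (i + 2))⁻¹) := by
  rw [← vyg_mul_self, ← mul_assoc, ← mul_assoc, eq_mul_inv_iff_mul_eq, mul_assoc,
    ← vxg_mul_vyg (Nat.lt_succ_self i), ← mul_assoc, ← vyg_mul_self]

theorem vyg_mul_vxg_self (i : ℕ) :
    vyg i * vxg i = vxg i * vyg i * (vxg (i + 2) * (vxg (i + 1))⁻¹) := by
  rw [vxg_mul_vyg_self]; group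

/-! ### Normal forms with indices bounded below -/

/-- `NormalForm i g`: the element `g` is a product of blocks `x_k^a y_k^ε` with `ε ≤ 1` and
strictly increasing `k ≥ i`, followed by an element of `permSubgroup`. -/
inductive NormalForm : ℕ → VhatTau → Prop
  | perm (i : ℕ) {h : VhatTau} (hh : h ∈ permSubgroup) : NormalForm i h
  | block (i a : ℕ) {e : ℕ} (he : e ≤ 1) {w : VhatTau} (hw : NormalForm (i + 1) w) :
      NormalForm i (vxg i ^ a * vyg i ^ e * w)

theorem NormalForm.mono {i j : ℕ} {w : VhatTau} (hij : i ≤ j) (hw : NormalForm j w) :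
    NormalForm i w := by
  induction hij with
  | refl => exact hw
  | step _ ih =>
    refine ih ?_
    simpa using NormalForm.block _ 0 zero_le_one hw

theorem NormalForm.vxg_mul_self {i : ℕ} {w : VhatTau} (hw : NormalForm (i + 1) w) :
    NormalForm i (vxg i * w) := by
  simpa using NormalForm.block i 1 zero_le_one hw

theorem NormalForm.vyg_mul_self {i : ℕ} {w : VhatTau} (hw : NormalForm (i + 1) w) :
    NormalForm i (vyg i * w) := by
  simpa using NormalForm.block i 0 le_rfl hw

/-- A family that shifts its index past `x_i` and `y_i` shifts its index past a block. -/
theorem shift_mul_block {i : ℕ} {z : ℕ → VhatTau}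
    (hx : ∀ j, i < j → z j * vxg i = vxg i * z (j + 1))
    (hy : ∀ j, i < j → z j * vyg i = vyg i * z (j + 1)) (a e : ℕ) {j : ℕ} (hj : i < j) :
    z j * (vxg i ^ a * vyg i ^ e) = vxg i ^ a * vyg i ^ e * z (j + (a + e)) := by
  induction a generalizing j with
  | zero =>
    induction e generalizing j with
    | zero => simp
    | succ e ih =>
      have := @ih (j + 1) (by omega)
      simp only [pow_zero, one_mul] at this ⊢
      rw [pow_succ', ← mul_assoc, hy j hj, mul_assoc, this, mul_assoc]
      congr 3; omega
  | succ a ih =>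
    have := @ih (j + 1) (by omega)
    rw [pow_succ', mul_assoc (vxg i), ← mul_assoc, hx j hj, mul_assoc, this, mul_assoc (vxg i)]
    congr 3; omega

theorem vxg_mul_block {i j : ℕ} (a e : ℕ) (hj : i < j) :
    vxg j * (vxg i ^ a * vyg i ^ e) = vxg i ^ a * vyg i ^ e * vxg (j + (a + e)) :=
  shift_mul_block (fun _ => vxg_mul_vxg) (fun _ => vxg_mul_vyg) a e hj

theorem vyg_mul_block {i j : ℕ} (a e : ℕ) (hj : i < j) :
    vyg j * (vxg i ^ a * vyg i ^ e) = vxg i ^ a * vyg i ^ e * vyg (j + (a + e)) :=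
  shift_mul_block (fun _ => vyg_mul_vxg) (fun _ => vyg_mul_vyg) a e hj

theorem vxg_inv_mul_block {i j : ℕ} (a e : ℕ) (hj : i < j) :
    (vxg j)⁻¹ * (vxg i ^ a * vyg i ^ e) = vxg i ^ a * vyg i ^ e * (vxg (j + (a + e)))⁻¹ := by
  rw [inv_mul_eq_iff_eq_mul, ← mul_assoc, vxg_mul_block a e hj, mul_inv_cancel_right]

/-- Multiplying by `x_i⁻¹` shifts normal forms of larger index. -/
theorem NormalForm.vxg_inv_mul_of_lt {i k : ℕ} {w : VhatTau} (hw : NormalForm k w)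
    (hik : i < k) : NormalForm (k + 1) ((vxg i)⁻¹ * w) := by
  induction hw with
  | perm k hh => exact .perm _ (mul_mem (inv_mem (vxg_mem i)) hh)
  | block k a he hw ih =>
    rename_i e w
    have hx : SemiconjBy (vxg i) (vxg (k + 1)) (vxg k) := (vxg_mul_vxg hik).symm
    have hy : SemiconjBy (vxg i) (vyg (k + 1)) (vyg k) := (vyg_mul_vxg hik).symm
    have hb := ((hx.pow_right a).mul_right (hy.pow_right e)).inv_symm_left
    rw [← mul_assoc, hb.eq, mul_assoc]
    exact .block _ _ he (ih (by omega))

theorem NormalForm.vxg_mul_and_inv_mul {i : ℕ} {w : VhatTau} (hw : NormalForm i w) :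
    ∀ j, i ≤ j → NormalForm i (vxg j * w) ∧ NormalForm i ((vxg j)⁻¹ * w) := by
  induction hw with
  | perm i hh =>
    intro j _
    exact ⟨.perm _ (mul_mem (vxg_mem j) hh), .perm _ (mul_mem (inv_mem (vxg_mem j)) hh)⟩
  | block i a he hw ih =>
    rename_i e w
    intro j hij
    rcases hij.eq_or_lt with rfl | hij
    · constructor
      · rw [← mul_assoc, ← mul_assoc, ← pow_succ']
        exact .block _ _ he hw
      · cases a with
        | succ a =>
          rw [pow_succ', mul_assoc (vxg i), mul_assoc (vxg i), inv_mul_cancel_left]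
          exact .block _ _ he hw
        | zero =>
          have h1 := hw.vxg_inv_mul_of_lt (Nat.lt_succ_self i)
          interval_cases e
          · simpa using mono (by omega) h1
          · have h2 := h1.vxg_inv_mul_of_lt (Nat.lt_succ_self (i + 1))
            have key : (vxg i)⁻¹ * vyg i =
                vyg i * (vxg (i + 2) * ((vxg (i + 1))⁻¹ * (vxg i)⁻¹)) := by
              rw [inv_mul_eq_iff_eq_mul, ← mul_assoc, vxg_mul_vyg_self]; group
            rw [pow_zero, one_mul, pow_one, ← mul_assoc, key]
            simp only [mul_assoc]
            exact vyg_mul_self (mono (by omega) h2.vxg_mul_self)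
    · constructor
      · rw [← mul_assoc, vxg_mul_block _ _ hij, mul_assoc]
        exact .block _ _ he (ih _ (by omega)).1
      · rw [← mul_assoc, vxg_inv_mul_block _ _ hij, mul_assoc]
        exact .block _ _ he (ih _ (by omega)).2

/-- A block may be preceded by `y_i` at the same index. -/
theorem NormalForm.vyg_mul_block_self {i : ℕ} (a : ℕ) {e : ℕ} (he : e ≤ 1) {w : VhatTau}
    (hw : NormalForm (i + 1) w) : NormalForm i (vyg i * (vxg i ^ a * vyg i ^ e * w)) := by
  induction a generalizing w with
  | zero =>
    interval_cases e
    · simpa using vyg_mul_self hw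
    · rw [pow_zero, one_mul, pow_one, ← mul_assoc, VhatTau.vyg_mul_self, mul_assoc]
      exact vxg_mul_self (hw.vxg_mul_and_inv_mul _ le_rfl).1
  | succ a ih =>
    have key : vyg i * (vxg i ^ (a + 1) * vyg i ^ e * w) =
        vxg i * (vyg i * (vxg i ^ a * vyg i ^ e *
          (vxg (i + 2 + (a + e)) * ((vxg (i + 1 + (a + e)))⁻¹ * w)))) := by
      calc vyg i * (vxg i ^ (a + 1) * vyg i ^ e * w)
          = vyg i * vxg i * (vxg i ^ a * vyg i ^ e) * w := by
            rw [pow_succ']; simp only [mul_assoc]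
        _ = vxg i * vyg i * vxg (i + 2) *
              ((vxg (i + 1))⁻¹ * (vxg i ^ a * vyg i ^ e)) * w := by
            rw [VhatTau.vyg_mul_vxg_self]; simp only [mul_assoc]
        _ = vxg i * vyg i * (vxg (i + 2) * (vxg i ^ a * vyg i ^ e)) *
              (vxg (i + 1 + (a + e)))⁻¹ * w := by
            rw [vxg_inv_mul_block _ _ (by omega)]; simp only [mul_assoc]
        _ = _ := by
            rw [vxg_mul_block _ _ (by omega)]; simp only [mul_assoc]
    rw [key]
    refine (NormalForm.vxg_mul_and_inv_mul (ih ?_) i le_rfl).1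
    refine (NormalForm.vxg_mul_and_inv_mul ?_ _ (by omega)).1
    exact (hw.vxg_mul_and_inv_mul _ (by omega)).2

theorem NormalForm.vyg_mul {i : ℕ} {w : VhatTau} (hw : NormalForm i w) :
    ∀ j, i ≤ j → NormalForm i (vyg j * w) := by
  induction hw with
  | perm i hh =>
    intro j hij
    exact mono hij (vyg_mul_self (.perm _ hh))
  | block i a he hw ih =>
    intro j hij
    rcases hij.eq_or_lt with rfl | hij
    · exact vyg_mul_block_self a he hw
    · rw [← mul_assoc, vyg_mul_block _ _ hij, mul_assoc]
      exact .block _ _ he (ih _ (by omega))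

/-- A normal form written as an explicit product of blocks. -/
theorem NormalForm.exists_prod {i : ℕ} {w : VhatTau} (hw : NormalForm i w) :
    ∃ (n : ℕ) (a ε : ℕ → ℕ), (∀ k, ε k ≤ 1) ∧ ∃ h ∈ permSubgroup,
      w = ((List.range' i (n + 1)).map fun k => vxg k ^ a k * vyg k ^ ε k).prod * h := by
  induction hw with
  | perm i hh => exact ⟨0, 0, 0, by simp, _, hh, by simp⟩
  | block i b he hw ih =>
    rename_i e w
    obtain ⟨n, a, ε, hε, h, hh, rfl⟩ := ih
    refine ⟨n + 1, Function.update a i b, Function.update ε i e, fun k => ?_, h, hh, ?_⟩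
    · rcases eq_or_ne k i with rfl | hk
      · simpa using he
      · simpa [hk] using hε k
    · rw [List.range'_succ (n := n + 1), List.map_cons, List.prod_cons, ← mul_assoc]
      congr 2
      · simp
      · refine congrArg List.prod (List.map_congr_left fun k hk => ?_)
        have hki : k ≠ i := by
          have := (List.mem_range'_1.mp hk).1
          omega
        simp [hki]

/-! ### Moving permutations past positive words -/

/-- The monoid generated by `c_{n+1}` and `π_0, …, π_n`. -/
def permMonoid (n : ℕ) : Submonoid VhatTau :=
  Submonoid.closure ({cSucc n} ∪ vpg '' Set.Iic n)

theorem cSucc_mem_permMonoid (n : ℕ) : cSucc n ∈ permMonoid n :=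
  Submonoid.subset_closure (Or.inl rfl)

theorem vpg_mem_permMonoid {n k : ℕ} (hk : k ≤ n) : vpg k ∈ permMonoid n :=
  Submonoid.subset_closure (Or.inr ⟨k, hk, rfl⟩)

/-- The caret `x_j` at the `j`-th leaf of the vine with leaves `0, …, n + 2`; splitting the last
leaf is trivial. -/
def leafCaret (n j : ℕ) : VhatTau := if j ≤ n + 1 then vxg j else 1

theorem leafCaret_of_le {n j : ℕ} (h : j ≤ n + 1) : leafCaret n j = vxg j := if_pos h

theorem leafCaret_last (n : ℕ) : leafCaret n (n + 2) = 1 := if_neg (by omega)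

/-- `MovesCarets n σ`: the element `σ` permutes the carets of the vine with leaves
`0, …, n + 2`, up to the permutations of the next vine. -/
def MovesCarets (n : ℕ) (σ : VhatTau) : Prop :=
  ∀ j ≤ n + 2, ∃ j' ≤ n + 2, ∃ τ ∈ permMonoid (n + 1),
    σ * leafCaret n j = leafCaret n j' * τ

theorem MovesCarets.one (n : ℕ) : MovesCarets n 1 :=
  fun j hj => ⟨j, hj, 1, one_mem _, by simp⟩

theorem MovesCarets.mul {n : ℕ} {σ τ : VhatTau} (hσ : MovesCarets n σ)
    (hτ : MovesCarets n τ) : MovesCarets n (σ * τ) := by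
  intro j hj
  obtain ⟨j₁, hj₁, τ₁, hτ₁, h₁⟩ := hτ j hj
  obtain ⟨j₂, hj₂, τ₂, hτ₂, h₂⟩ := hσ j₁ hj₁
  exact ⟨j₂, hj₂, τ₂ * τ₁, mul_mem hτ₂ hτ₁, by rw [mul_assoc, h₁, ← mul_assoc, h₂, mul_assoc]⟩

theorem movesCarets_vpg {n k : ℕ} (hk : k ≤ n) : MovesCarets n (vpg k) := by
  intro j hj
  have h0 : vpg k ∈ permMonoid (n + 1) := vpg_mem_permMonoid (by omega)
  have h1 : vpg (k + 1) ∈ permMonoid (n + 1) := vpg_mem_permMonoid (by omega)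
  rcases hj.eq_or_lt with rfl | hj
  · exact ⟨n + 2, le_rfl, _, h0, by simp [leafCaret_last]⟩
  rw [leafCaret_of_le (by omega)]
  obtain hjk | rfl | rfl | hjk : j < k ∨ j = k ∨ j = k + 1 ∨ k + 2 ≤ j := by omega
  · exact ⟨j, by omega, _, h1, by rw [leafCaret_of_le (by omega), vpg_mul_vxg_of_lt hjk]⟩
  · exact ⟨j + 1, by omega, _, mul_mem h0 h1,
      by rw [leafCaret_of_le (by omega), vpg_mul_vxg_self, mul_assoc]⟩
  · exact ⟨k, by omega, _, mul_mem h1 h0,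
      by rw [leafCaret_of_le (by omega), vpg_mul_vxg_succ, mul_assoc]⟩
  · exact ⟨j, by omega, _, h0,
      by rw [leafCaret_of_le (by omega), vpg_mul_vxg_of_add_two_le hjk]⟩

theorem vxg_one_eq : vxg 1 = vpg 0 * vxg 0 * (vpg 1 * vpg 0) := by
  have h := congrArg (vpg 0 * ·) (vpg_mul_vxg_succ 0)
  simp only [← mul_assoc, vpg_mul_self, one_mul, zero_add] at h
  rw [h]
  simp only [mul_assoc]

theorem vyg_one_eq : vyg 1 = vpg 0 * vyg 0 * (vpg 1 * vpg 0) := by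
  have h := congrArg (vpg 0 * ·) (vpg_mul_vyg_succ 0)
  simp only [← mul_assoc, vpg_mul_self, one_mul, zero_add] at h
  rw [h]
  simp only [mul_assoc]

/-- The product `π_0 π_1 ⋯ π_n` inherits multiplicative properties of the `π_k`. -/
theorem prod_vpg_induction {p : VhatTau → Prop} (h1 : p 1)
    (hmul : ∀ a b, p a → p b → p (a * b)) {n : ℕ} (h : ∀ k ≤ n, p (vpg k)) :
    p ((List.range (n + 1)).map vpg).prod := by
  have hl : ∀ l : List ℕ, (∀ k ∈ l, p (vpg k)) → p (l.map vpg).prod := by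
    intro l
    induction l with
    | nil => intro _; simpa using h1
    | cons a l ih =>
      intro hl
      rw [List.map_cons, List.prod_cons]
      exact hmul _ _ (hl a (by simp)) (ih fun k hk => hl k (by simp [hk]))
  exact hl _ fun k hk => h k (by have := List.mem_range.mp hk; omega)

theorem movesCarets_cSucc (n : ℕ) : MovesCarets n (cSucc n) := by
  intro j hj
  have hc := cSucc_mem_permMonoid (n + 1)
  rcases hj.eq_or_lt with rfl | hj
  · exact ⟨n + 1, by omega, _, hc,
      by rw [leafCaret_last, mul_one, leafCaret_of_le le_rfl, cSucc_eq n]⟩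
  rw [leafCaret_of_le (by omega)]
  match j with
  | 0 =>
    exact ⟨n + 2, le_rfl, _, pow_mem hc 2, by rw [leafCaret_last, one_mul, cSucc_mul_vxg_zero]⟩
  | 1 =>
    obtain ⟨j', hj', τ, hτ, h⟩ := prod_vpg_induction (p := MovesCarets n) (MovesCarets.one n)
      (fun _ _ => MovesCarets.mul) (fun k hk => movesCarets_vpg hk) (n + 1) (by omega)
    rw [leafCaret_of_le le_rfl] at h
    refine ⟨j', hj', τ * (cSucc (n + 1) ^ 3 * (vpg 1 * vpg 0)),
      mul_mem hτ (mul_mem (pow_mem hc 3) (mul_mem (vpg_mem_permMonoid (by omega))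
        (vpg_mem_permMonoid (by omega)))), ?_⟩
    have h3 : cSucc n ^ 2 * vxg 0 = vxg (n + 1) * cSucc (n + 1) ^ 3 := by
      rw [pow_two, mul_assoc, cSucc_mul_vxg_zero, cSucc_eq n, mul_assoc, ← pow_succ']
    rw [vxg_one_eq, ← mul_assoc (cSucc n), ← mul_assoc (cSucc n),
      cSucc_mul_vpg_zero, mul_assoc _ _ (vxg 0), h3, ← mul_assoc (List.prod _), h]
    simp only [mul_assoc]
  | k + 2 =>
    exact ⟨k + 1, by omega, _, hc, by
      rw [leafCaret_of_le (by omega), cSucc_mul_vxg_succ (by omega) (by omega)]⟩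

theorem movesCarets_of_mem {n : ℕ} {σ : VhatTau} (hσ : σ ∈ permMonoid n) :
    MovesCarets n σ := by
  induction hσ using Submonoid.closure_induction with
  | mem σ hσ =>
    rcases hσ with rfl | ⟨k, hk, rfl⟩
    · exact movesCarets_cSucc n
    · exact movesCarets_vpg hk
  | one => exact .one n
  | mul _ _ _ _ h₁ h₂ => exact h₁.mul h₂

/-- `MovesY n σ`: the element `σ` permutes the cosets of `y_0, …, y_{n+2}` modulo
`permSubgroup`. -/
def MovesY (n : ℕ) (σ : VhatTau) : Prop :=
  ∀ j ≤ n + 2, ∃ j' ≤ n + 2, ∃ h ∈ permSubgroup, σ * vyg j = vyg j' * h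

theorem MovesY.one (n : ℕ) : MovesY n 1 :=
  fun j hj => ⟨j, hj, 1, one_mem _, by simp⟩

theorem MovesY.mul {n : ℕ} {σ τ : VhatTau} (hσ : MovesY n σ) (hτ : MovesY n τ) :
    MovesY n (σ * τ) := by
  intro j hj
  obtain ⟨j₁, hj₁, τ₁, hτ₁, h₁⟩ := hτ j hj
  obtain ⟨j₂, hj₂, τ₂, hτ₂, h₂⟩ := hσ j₁ hj₁
  exact ⟨j₂, hj₂, τ₂ * τ₁, mul_mem hτ₂ hτ₁, by rw [mul_assoc, h₁, ← mul_assoc, h₂, mul_assoc]⟩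

theorem movesY_vpg {n k : ℕ} (hk : k ≤ n) : MovesY n (vpg k) := by
  intro j hj
  have h0 := vpg_mem k
  have h1 := vpg_mem (k + 1)
  obtain hjk | rfl | rfl | hjk : j < k ∨ j = k ∨ j = k + 1 ∨ k + 2 ≤ j := by omega
  · exact ⟨j, hj, _, h1, vpg_mul_vyg_of_lt hjk⟩
  · exact ⟨j + 1, by omega, _, mul_mem h0 h1, by rw [vpg_mul_vyg_self, mul_assoc]⟩
  · exact ⟨k, by omega, _, mul_mem h1 h0, by rw [vpg_mul_vyg_succ, mul_assoc]⟩
  · exact ⟨j, hj, _, h0, vpg_mul_vyg_of_add_two_le hjk⟩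

theorem cSucc_mul_vyg_zero_eq (n : ℕ) :
    ∃ h ∈ permSubgroup, cSucc n * vyg 0 = vyg (n + 2) * h := by
  refine ⟨_, ?_, by rw [cSucc_mul_vyg_zero, vyg_inv_eq, mul_assoc]⟩
  exact mul_mem (mul_mem (inv_mem (vxg_mem _)) (inv_mem (vxg_mem _))) (pow_mem (cSucc_mem _) _)

theorem cSucc_mul_vyg_last_eq (n : ℕ) :
    ∃ h ∈ permSubgroup, cSucc n * vyg (n + 2) = vyg (n + 1) * h := by
  refine ⟨_, ?_, by rw [cSucc_eq n, mul_assoc, cSucc_mul_vyg_succ (by omega) le_rfl,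
    ← mul_assoc, vxg_mul_vyg_self, mul_assoc]⟩
  exact mul_mem (mul_mem (mul_mem (vxg_mem _) (vxg_mem _)) (inv_mem (vxg_mem _))) (cSucc_mem _)

theorem movesY_cSucc (n : ℕ) : MovesY n (cSucc n) := by
  intro j hj
  rcases hj.eq_or_lt with rfl | hj
  · exact ⟨n + 1, by omega, cSucc_mul_vyg_last_eq n⟩
  match j with
  | 0 => exact ⟨n + 2, le_rfl, cSucc_mul_vyg_zero_eq n⟩
  | 1 =>
    obtain ⟨h₁, hh₁, e₁⟩ := cSucc_mul_vyg_zero_eq n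
    obtain ⟨h₂, hh₂, e₂⟩ := cSucc_mul_vyg_last_eq n
    obtain ⟨j', hj', h₃, hh₃, e₃⟩ := prod_vpg_induction (p := MovesY n) (MovesY.one n)
      (fun _ _ => MovesY.mul) (fun k hk => movesY_vpg hk) (n + 1) (by omega)
    refine ⟨j', hj', h₃ * (h₂ * (h₁ * (vpg 1 * vpg 0))),
      mul_mem hh₃ (mul_mem hh₂ (mul_mem hh₁ (mul_mem (vpg_mem _) (vpg_mem _)))), ?_⟩
    have h4 : cSucc n ^ 2 * vyg 0 = vyg (n + 1) * (h₂ * h₁) := by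
      rw [pow_two, mul_assoc, e₁, ← mul_assoc, e₂, mul_assoc]
    rw [vyg_one_eq, ← mul_assoc (cSucc n), ← mul_assoc (cSucc n),
      cSucc_mul_vpg_zero, mul_assoc _ _ (vyg 0), h4, ← mul_assoc (List.prod _), e₃]
    simp only [mul_assoc]
  | k + 2 =>
    exact ⟨k + 1, by omega, _, cSucc_mem _, cSucc_mul_vyg_succ (by omega) (by omega)⟩

theorem movesY_of_mem {n : ℕ} {σ : VhatTau} (hσ : σ ∈ permMonoid n) : MovesY n σ := by
  induction hσ using Submonoid.closure_induction with
  | mem σ hσ =>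
    rcases hσ with rfl | ⟨k, hk, rfl⟩
    · exact movesY_cSucc n
    · exact movesY_vpg hk
  | one => exact .one n
  | mul _ _ _ _ h₁ h₂ => exact h₁.mul h₂

/-- The monoid generated by the `x_n`. -/
def posX : Submonoid VhatTau := Submonoid.closure (Set.range vxg)

theorem vxg_mem_posX (n : ℕ) : vxg n ∈ posX := Submonoid.subset_closure ⟨n, rfl⟩

theorem leafCaret_mem_posX (n j : ℕ) : leafCaret n j ∈ posX := by
  unfold leafCaret
  split_ifs
  exacts [vxg_mem_posX j, one_mem _]

/-- `SingleY g`: the element `g` is a positive word in the `x_n`, followed by a single `y_i`,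
followed by an element of `permSubgroup`. -/
def SingleY (g : VhatTau) : Prop :=
  ∃ m ∈ posX, ∃ i, ∃ h ∈ permSubgroup, g = m * vyg i * h

theorem SingleY.posX_mul {m g : VhatTau} (hm : m ∈ posX) (hg : SingleY g) :
    SingleY (m * g) := by
  obtain ⟨m', hm', i, h, hh, rfl⟩ := hg
  exact ⟨m * m', mul_mem hm hm', i, h, hh, by simp only [mul_assoc]⟩

theorem SingleY.mul_perm {g h : VhatTau} (hg : SingleY g) (hh : h ∈ permSubgroup) :
    SingleY (g * h) := by
  obtain ⟨m, hm, i, h', hh', rfl⟩ := hg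
  exact ⟨m, hm, i, h' * h, mul_mem hh' hh, by simp only [mul_assoc]⟩

theorem exists_permMonoid_mul_singleY {m : VhatTau} (hm : m ∈ posX) (i : ℕ) :
    ∃ N, ∀ n ≥ N, ∀ σ ∈ permMonoid n, SingleY (σ * (m * vyg i)) := by
  induction hm using Submonoid.closure_induction_left with
  | one =>
    refine ⟨i, fun n hn σ hσ => ?_⟩
    obtain ⟨i', _, h, hh, e⟩ := movesY_of_mem hσ i (by omega)
    exact ⟨1, one_mem _, i', h, hh, by simpa using e⟩
  | mul_left x hx m hm ih =>
    obtain ⟨j, rfl⟩ := hx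
    obtain ⟨N, hN⟩ := ih
    refine ⟨max N j, fun n hn σ hσ => ?_⟩
    rw [ge_iff_le, max_le_iff] at hn
    obtain ⟨j', _, τ, hτ, e⟩ := movesCarets_of_mem hσ j (by omega)
    rw [leafCaret_of_le (by omega)] at e
    rw [mul_assoc (vxg j), ← mul_assoc, e, mul_assoc]
    exact (hN (n + 1) (by omega) τ hτ).posX_mul (leafCaret_mem_posX _ _)

theorem exists_cSucc_eq_mul {k n : ℕ} (h : k ≤ n) :
    ∃ m ∈ posX, cSucc k = m * cSucc n := by
  induction h with
  | refl => exact ⟨1, one_mem _, by simp⟩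
  | step _ ih =>
    rename_i n _
    obtain ⟨m, hm, e⟩ := ih
    exact ⟨m * vxg (n + 1), mul_mem hm (vxg_mem_posX _), by
      rw [e, cSucc_eq n, mul_assoc]⟩

theorem SingleY.cSucc_mul {g : VhatTau} (k : ℕ) (hg : SingleY g) : SingleY (cSucc k * g) := by
  obtain ⟨m, hm, i, h, hh, rfl⟩ := hg
  obtain ⟨N, hN⟩ := exists_permMonoid_mul_singleY hm i
  obtain ⟨m', hm', e⟩ := exists_cSucc_eq_mul (le_max_left k N)
  rw [e, mul_assoc, ← mul_assoc (cSucc _)]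
  exact ((hN _ (le_max_right k N) _ (cSucc_mem_permMonoid _)).mul_perm hh).posX_mul hm'

theorem SingleY.vpg_mul {g : VhatTau} (k : ℕ) (hg : SingleY g) : SingleY (vpg k * g) := by
  obtain ⟨m, hm, i, h, hh, rfl⟩ := hg
  obtain ⟨N, hN⟩ := exists_permMonoid_mul_singleY hm i
  rw [← mul_assoc]
  exact (hN _ (le_max_right k N) _ (vpg_mem_permMonoid (le_max_left k N))).mul_perm hh

theorem SingleY.perm_mul {σ g : VhatTau} (hσ : σ ∈ permSubgroup) (hg : SingleY g) :
    SingleY (σ * g) := by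
  induction hσ using Subgroup.closure_induction_left with
  | one => simpa using hg
  | mul_left s hs τ hτ ih =>
    rw [mul_assoc]
    rcases hs with ⟨n, rfl⟩ | ⟨k, rfl⟩
    · rw [← n.succPNat_natPred]
      exact ih.cSucc_mul _
    · exact ih.vpg_mul k
  | inv_mul_cancel s hs τ hτ ih =>
    rw [mul_assoc]
    rcases hs with ⟨n, rfl⟩ | ⟨k, rfl⟩
    · rw [← n.succPNat_natPred]
      change SingleY ((cSucc n.natPred)⁻¹ * _)
      rw [inv_eq_of_mul_eq_one_right (show cSucc n.natPred * cSucc n.natPred ^ (n.natPred + 2) = 1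
        by rw [← pow_succ', cSucc_pow])]
      generalize n.natPred + 2 = t
      induction t with
      | zero => simpa using ih
      | succ t iht =>
        rw [pow_succ', mul_assoc]
        exact iht.cSucc_mul _
    · rw [inv_eq_of_mul_eq_one_right (vpg_mul_self k)]
      exact ih.vpg_mul k

/-! ### Every element has a normal form -/

theorem NormalForm.posX_mul {m w : VhatTau} (hm : m ∈ posX) (hw : NormalForm 0 w) :
    NormalForm 0 (m * w) := by
  induction hm using Submonoid.closure_induction_left with
  | one => simpa using hw
  | mul_left x hx m hm ih =>
    obtain ⟨j, rfl⟩ := hx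
    rw [mul_assoc]
    exact (ih.vxg_mul_and_inv_mul j (Nat.zero_le j)).1

theorem SingleY.normalForm_mul {s g : VhatTau} (hs : SingleY s)
    (hg : ∀ h ∈ permSubgroup, NormalForm 0 (h * g)) : NormalForm 0 (s * g) := by
  obtain ⟨m, hm, i, h, hh, rfl⟩ := hs
  rw [mul_assoc, mul_assoc]
  exact NormalForm.posX_mul hm ((hg h hh).vyg_mul i (Nat.zero_le i))

theorem singleY_perm_mul_vyg {h : VhatTau} (hh : h ∈ permSubgroup) (i : ℕ) :
    SingleY (h * vyg i) :=
  SingleY.perm_mul hh ⟨1, one_mem _, i, 1, one_mem _, by simp⟩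

theorem closure_perm_vyg : Subgroup.closure (permSubgroup ∪ Set.range vyg) = ⊤ := by
  rw [eq_top_iff, ← PresentedGroup.closure_range_of, Subgroup.closure_le]
  rintro _ ⟨g, rfl⟩
  cases g with
  | x n => exact Subgroup.subset_closure (Or.inl (vxg_mem n))
  | y n => exact Subgroup.subset_closure (Or.inr ⟨n, rfl⟩)
  | p n => exact Subgroup.subset_closure (Or.inl (vpg_mem n))
  | c n => exact Subgroup.subset_closure (Or.inl (Subgroup.subset_closure (Or.inl ⟨n, rfl⟩)))

theorem normalForm_perm_mul (g : VhatTau) : ∀ h ∈ permSubgroup, NormalForm 0 (h * g) := by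
  have hg : g ∈ Subgroup.closure (permSubgroup ∪ Set.range vyg) := by
    rw [closure_perm_vyg]; trivial
  induction hg using Subgroup.closure_induction_left with
  | one => intro h hh; exact .perm _ (by simpa using hh)
  | mul_left s hs g hg ih =>
    intro h hh
    rw [← mul_assoc]
    rcases hs with hs | ⟨i, rfl⟩
    · exact ih _ (mul_mem hh hs)
    · exact (singleY_perm_mul_vyg hh i).normalForm_mul ih
  | inv_mul_cancel s hs g hg ih =>
    intro h hh
    rw [← mul_assoc]
    rcases hs with hs | ⟨i, rfl⟩
    · exact ih _ (mul_mem hh (inv_mem hs))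
    · rw [vyg_inv_eq, ← mul_assoc]
      exact ((singleY_perm_mul_vyg hh i).mul_perm
        (mul_mem (inv_mem (vxg_mem _)) (inv_mem (vxg_mem _)))).normalForm_mul ih

end VhatTau

/-- Every element of `V̂_τ` has a `p σ q⁻¹` form. -/
theorem VhatTau_pPiq_form (g : VhatTau) :
    ∃ (n m : ℕ) (a b : ℕ → ℕ) (ε : ℕ → ℕ) (σ : VhatTau),
      (∀ i, ε i ≤ 1) ∧
      σ ∈ Subgroup.closure (Set.range vcg ∪ Set.range vpg) ∧
      g = ((List.range (n + 1)).map (fun i => vxg i ^ a i * vyg i ^ ε i)).prod * σ *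
            (((List.range (m + 1)).map (fun j => vxg j ^ b j)).prod)⁻¹ := by
  have hg : VhatTau.NormalForm 0 g := by simpa using VhatTau.normalForm_perm_mul g 1 (one_mem _)
  obtain ⟨n, a, ε, hε, σ, hσ, e⟩ := hg.exists_prod
  refine ⟨n, 0, a, 0, ε, σ, hε, hσ, ?_⟩
  rw [e, List.range_eq_range' (n := n + 1)]
  simp

end
end
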